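/- For every integer n ≥ 0, writing M_i = M(i,11,·) at the indicated argument, the following crank equalities hold. At 11n: M_1 = M_2 = M_3 = M_4 = M_5. At 11n+1: M_0 + M_1 = 2M_2 and M_2 = M_3 = M_4 = M_5. At 11n+2: M_0 = M_1 = M_3 = M_4 = M_5. At 11n+3: M_0 = M_3 and M_1 = M_2 = M_4 = M_5. At 11n+4: M_0 = M_2 = M_4 and M_1 = M_3 = M_5. At 11n+5: M_0 = M_1 = M_3 = M_5 and M_2 = M_4. At 11n+6: M_0 = M_1 = M_2 = M_3 = M_4 = M_5 and 11·M_0 = p(11n+6). At 11n+7: M_0 = M_2 = M_3 = M_5 and M_1 = M_4. At 11n+8: M_0 = M_2 = M_5 and M_1 = M_3 = M_4. At 11n+9: M_0 = M_4 and M_1 = M_2 = M_3 = M_5. At 11n+10: M_0 = M_1 = M_2 = M_4 = M_5. -/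

import Mathlib

/-- `p n`: the number of partitions of `n`. -/
def partitionCount (n : ℕ) : ℕ := Fintype.card (Nat.Partition n)

/-- The rank of a partition: its largest part minus its number of parts
(the empty partition has rank 0). -/
def partitionRank {n : ℕ} (π : Nat.Partition n) : ℤ :=
  (π.parts.sup : ℤ) - (Multiset.card π.parts : ℤ)

/-- The crank of a partition `π`: if `π` has no parts equal to 1, it is the largest part;
otherwise it is (number of parts larger than the number of ones) − (number of ones). -/
def partitionCrank {n : ℕ} (π : Nat.Partition n) : ℤ :=
  if π.parts.count 1 = 0 then (π.parts.sup : ℤ)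
  else ((π.parts.filter fun x => π.parts.count 1 < x).card : ℤ) - (π.parts.count 1 : ℤ)

/-- `rankCount a r n` = `N(a,r,n)`: the number of partitions of `n` whose rank is
congruent to `a` modulo `r`. -/
def rankCount (a r : ℤ) (n : ℕ) : ℕ :=
  (Finset.univ.filter fun π : Nat.Partition n => partitionRank π % r = a % r).card

/-- `crankCount a n` = `M(a,11,n)`: for `n ≠ 1`, the number of partitions of `n` whose crank
is congruent to `a` modulo 11; at `n = 1` the standard convention `M(0,11,1) = −1`,
`M(1,11,1) = M(10,11,1) = 1`, and `M(a,11,1) = 0` otherwise. -/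
def crankCount (a : ℤ) (n : ℕ) : ℤ :=
  if n = 1 then
    if a % 11 = 0 then -1
    else if a % 11 = 1 ∨ a % 11 = 10 then 1
    else 0
  else ((Finset.univ.filter fun π : Nat.Partition n => partitionCrank π % 11 = a % 11).card : ℤ)

namespace CrankModEleven

open PowerSeries PowerSeries.WithPiTopology Filter Topology Finset

section Products
variable {R : Type*} [CommRing R]

/-- The finite product `(1 - x q) (1 - x q ^ 2) ⋯ (1 - x q ^ n)`. -/
noncomputable def finPoch (x : R) (n : ℕ) : R⟦X⟧ := ∏ i ∈ range n, (1 - C x * X ^ (i + 1))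

@[simp] lemma finPoch_zero (x : R) : finPoch x 0 = 1 := by simp [finPoch]

lemma finPoch_succ (x : R) (n : ℕ) :
    finPoch x (n + 1) = finPoch x n * (1 - C x * X ^ (n + 1)) := by
  simp [finPoch, prod_range_succ]

lemma constantCoeff_finPoch (x : R) (n : ℕ) : constantCoeff (finPoch x n) = 1 := by
  simp [finPoch, map_prod]

/-- The reciprocal of `(1 - q) ⋯ (1 - q ^ n)`, read as zero for negative `n`. -/
noncomputable def recipPoch (R : Type*) [CommRing R] (n : ℤ) : R⟦X⟧ :=
  if n < 0 then 0 else invOfUnit (finPoch 1 n.toNat) 1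

lemma recipPoch_of_neg {n : ℤ} (h : n < 0) : recipPoch R n = 0 := by simp [recipPoch, h]

lemma finPoch_mul_recipPoch (n : ℕ) : finPoch 1 n * recipPoch R n = 1 := by
  simp only [recipPoch, Int.toNat_natCast]
  rw [if_neg (by omega), mul_invOfUnit]
  simp [constantCoeff_finPoch]

lemma one_sub_mul_recipPoch (n : ℕ) :
    (1 - X ^ n) * recipPoch R n = recipPoch R (n - 1) := by
  rcases n with _ | n
  · simp [recipPoch_of_neg]
  · have h1 := finPoch_mul_recipPoch (R := R) (n + 1)
    have h2 := finPoch_mul_recipPoch (R := R) n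
    rw [finPoch_succ] at h1
    simp only [map_one, one_mul] at h1
    push_cast at h1 ⊢
    rw [show (n : ℤ) + 1 - 1 = n by ring]
    linear_combination recipPoch R n * h1 - (1 - X ^ (n + 1)) * recipPoch R (n + 1) * h2

lemma recipPoch_zero : recipPoch R 0 = 1 := by
  simpa using finPoch_mul_recipPoch (R := R) 0

lemma coeff_finPoch_of_le (x : R) {d n m : ℕ} (hn : d ≤ n) (hm : n ≤ m) :
    coeff d (finPoch x m) = coeff d (finPoch x n) := by
  induction m, hm using Nat.le_induction with
  | base => rfl
  | succ m hm ih =>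
    rw [finPoch_succ, mul_sub, mul_one, map_sub, ih, ← mul_assoc, coeff_mul_X_pow',
      if_neg (by omega), sub_zero]

variable [TopologicalSpace R]

lemma multipliable_one_sub_C_mul_X_pow (x : R) :
    Multipliable fun n : ℕ ↦ (1 - C x * X ^ (n + 1) : R⟦X⟧) := by
  simp_rw [sub_eq_add_neg]
  refine multipliable_one_add_of_tendsto_order_atTop_nhds_top R ?_
  refine ENat.tendsto_nhds_top_iff_natCast_lt.mpr fun n ↦ eventually_atTop.mpr ⟨n, fun m hm ↦ ?_⟩
  refine lt_of_lt_of_le (b := ((m + 1 : ℕ) : ℕ∞)) (by exact_mod_cast (by omega)) ?_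
  refine nat_le_order _ _ fun i hi ↦ ?_
  rw [map_neg, coeff_C_mul_X_pow, if_neg (by omega), neg_zero]

/-- The infinite product `∏ (1 - x q ^ n)` over `n ≥ 1`. -/
noncomputable def infPoch (x : R) : R⟦X⟧ := ∏' n : ℕ, (1 - C x * X ^ (n + 1))

lemma tendsto_finPoch (x : R) : Tendsto (finPoch x) atTop (𝓝 (infPoch x)) :=
  (multipliable_one_sub_C_mul_X_pow x).hasProd.tendsto_prod_nat

variable [T2Space R]

lemma coeff_infPoch (x : R) {d n : ℕ} (h : d ≤ n) :
    coeff d (infPoch x) = coeff d (finPoch x n) := by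
  refine tendsto_nhds_unique ((tendsto_iff_coeff_tendsto R _ _ _).mp (tendsto_finPoch x) d) ?_
  exact tendsto_atTop_of_eventually_const (i₀ := n) fun m hm ↦ coeff_finPoch_of_le x h hm

lemma X_pow_dvd_infPoch_sub (x : R) {N n : ℕ} (h : N ≤ n) :
    (X : R⟦X⟧) ^ N ∣ infPoch x - finPoch x n := by
  rw [X_pow_dvd_iff]
  intro m hm
  rw [map_sub, coeff_infPoch x (hm.le.trans h), sub_self]

lemma constantCoeff_infPoch (x : R) : constantCoeff (infPoch x) = 1 := by
  rw [← coeff_zero_eq_constantCoeff_apply, coeff_infPoch x le_rfl]; simp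

end Products

section Sums
variable {R : Type*} [CommRing R] [TopologicalSpace R]

lemma summable_C_mul_X_pow {ι : Type*} {e : ι → ℕ} (he : ∀ n, {i | e i = n}.Finite) (c : ι → R) :
    Summable fun i ↦ (C (c i) * X ^ e i : R⟦X⟧) := by
  rw [summable_iff_summable_coeff]
  intro d
  refine summable_of_hasFiniteSupport ((he d).subset fun i hi ↦ ?_)
  rw [Function.mem_support, coeff_C_mul_X_pow] at hi
  by_contra h
  exact hi (if_neg fun h' ↦ h h'.symm)

end Sums

section TripleProduct

/-- The binomial coefficient `k (k - 1) / 2`, for an arbitrary integer `k`. -/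
def tri (k : ℤ) : ℕ := (k * (k - 1) / 2).toNat

lemma two_mul_tri (k : ℤ) : 2 * (tri k : ℤ) = k * (k - 1) := by
  have h0 : 0 ≤ k * (k - 1) := by
    rcases le_or_gt k 0 with h | h <;> nlinarith
  have h1 : 2 ∣ k * (k - 1) := by
    have := (Int.even_mul_pred_self k).two_dvd
    exact this
  rw [tri, Int.toNat_of_nonneg (by omega)]
  omega

lemma finite_fiber_of_abs_le {e : ℤ → ℕ} (h : ∀ k, |k| ≤ e k + 1) (n : ℕ) :
    {k | e k = n}.Finite := by
  refine (Set.finite_Icc (-(n + 1 : ℤ)) (n + 1)).subset fun k hk ↦ ?_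
  have := h k
  rw [Set.mem_ofPred_eq] at hk
  rw [hk] at this
  exact abs_le.mp this

lemma abs_le_tri (k : ℤ) : |k| ≤ tri k + 1 := by
  have := two_mul_tri k
  rw [abs_le]
  constructor <;> nlinarith [sq_nonneg (k-1), sq_nonneg (k-2), sq_nonneg (k+1)]

variable {R : Type*} [CommRing R]

/-- The `k`-th term of the finite form of the triple product expansion. -/
noncomputable def finTerm (x : Rˣ) (M : ℕ) (k : ℤ) : R⟦X⟧ :=
  C (((-x) ^ k : Rˣ) : R) * X ^ tri k
    * (finPoch 1 (2 * M) * recipPoch R (M + k) * recipPoch R (M - k))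

lemma recip_identity (M : ℕ) (u v : ℕ) (h : u + v = 2 * M + 2) :
    (1 - X ^ (2 * M + 1)) * (1 - X ^ (2 * M + 2)) * (recipPoch R u * recipPoch R v)
      = (1 + X ^ (2 * M + 1)) * (recipPoch R (u - 1) * recipPoch R (v - 1))
        + X ^ v * (recipPoch R (u - 2) * recipPoch R v)
        + X ^ u * (recipPoch R u * recipPoch R (v - 2)) := by
  have key (n : ℕ) : X * recipPoch R (n - 2) = (X - X ^ n) * recipPoch R (n - 1) := by
    rcases n with _ | n
    · simp [recipPoch_of_neg]
    · have := one_sub_mul_recipPoch (R := R) n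
      push_cast
      rw [show (n : ℤ) + 1 - 2 = n - 1 by ring, ← this]
      simp only [add_sub_cancel_right]
      ring
  have hu := one_sub_mul_recipPoch (R := R) u
  have hv := one_sub_mul_recipPoch (R := R) v
  have ku := key u
  have kv := key v
  rw [← hu] at ku ⊢
  rw [← hv] at kv ⊢
  have hX : (X : R⟦X⟧) * X ^ (2 * M + 1) = X ^ u * X ^ v := by
    rw [← pow_succ', ← pow_add]; congr 1; omega
  have hX' : (X : R⟦X⟧) ^ (2 * M + 2) = X ^ u * X ^ v := by
    rw [← pow_add]; congr 1; omega
  refine X_mul_inj.mp ?_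
  rw [hX']
  linear_combination (-X ^ v * recipPoch R v) * ku - X ^ u * recipPoch R u * kv
    + (- recipPoch R u * recipPoch R v * (1 - X ^ u * X ^ v)
      - recipPoch R u * recipPoch R v * (1 - X ^ u) * (1 - X ^ v)) * hX

end TripleProduct

section TripleProduct
variable {R : Type*} [CommRing R]

lemma finTerm_of_lt (x : Rˣ) {M : ℕ} {k : ℤ} (h : M < |k|) : finTerm x M k = 0 := by
  rcases lt_abs.mp h with h | h
  · rw [finTerm, recipPoch_of_neg (n := M - k) (by omega)]; simp
  · rw [finTerm, recipPoch_of_neg (n := M + k) (by omega)]; simp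

lemma finTerm_succ (x : Rˣ) (M : ℕ) (k : ℤ) :
    finTerm x (M + 1) k = (1 + X ^ (2 * M + 1)) * finTerm x M k
      + -(C (x : R) * X ^ M) * finTerm x M (k - 1)
      + -(C ((x⁻¹ : Rˣ) : R) * X ^ (M + 1)) * finTerm x M (k + 1) := by
  rcases lt_or_ge ((M + 1 : ℕ) : ℤ) |k| with h | h
  · rw [finTerm_of_lt x h, finTerm_of_lt, finTerm_of_lt, finTerm_of_lt]
    · simp
    all_goals rw [lt_abs] at h ⊢; push_cast at h; omega
  obtain ⟨hl, hr⟩ := abs_le.mp h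
  push_cast at hl hr
  obtain ⟨u, hu⟩ := Int.eq_ofNat_of_zero_le (a := M + 1 + k) (by omega)
  obtain ⟨v, hv⟩ := Int.eq_ofNat_of_zero_le (a := M + 1 - k) (by omega)
  have hT := two_mul_tri k
  have hT1 := two_mul_tri (k - 1)
  have hT2 := two_mul_tri (k + 1)
  have e1 : M + tri (k - 1) = tri k + v := by zify; linarith
  have e2 : (M + 1) + tri (k + 1) = tri k + u := by zify; linarith
  have e1' : (X : R⟦X⟧) ^ M * X ^ tri (k - 1) = X ^ tri k * X ^ v := by
    rw [← pow_add, ← pow_add, e1]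
  have e2' : (X : R⟦X⟧) ^ (M + 1) * X ^ tri (k + 1) = X ^ tri k * X ^ u := by
    rw [← pow_add, ← pow_add, e2]
  have c1 : (C (x : R) : R⟦X⟧) * C (((-x) ^ (k - 1) : Rˣ) : R) = - C (((-x) ^ k : Rˣ) : R) := by
    rw [← map_mul, ← map_neg, zpow_sub_one]
    congr 1
    simp only [Units.val_neg, Units.val_mul, inv_neg, mul_neg, neg_inj]
    rw [mul_left_comm]
    simp
  have c2 : (C ((x⁻¹ : Rˣ) : R) : R⟦X⟧) * C (((-x) ^ (k + 1) : Rˣ) : R)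
      = - C (((-x) ^ k : Rˣ) : R) := by
    rw [← map_mul, ← map_neg, zpow_add_one]
    congr 1
    simp only [Units.val_neg, Units.val_mul, mul_neg, neg_inj]
    rw [mul_left_comm]
    simp
  have key := recip_identity (R := R) M u v (by omega)
  simp only [finTerm]
  rw [show 2 * (M + 1) = 2 * M + 1 + 1 by ring, finPoch_succ, finPoch_succ]
  push_cast
  rw [show (M : ℤ) + 1 + k = u by omega, show (M : ℤ) + 1 - k = v by omega,
    show (M : ℤ) + k = u - 1 by omega, show (M : ℤ) - k = v - 1 by omega,
    show (M : ℤ) + (k - 1) = u - 2 by omega, show (M : ℤ) - (k - 1) = v by omega,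
    show (M : ℤ) + (k + 1) = u by omega, show (M : ℤ) - (k + 1) = v - 2 by omega]
  simp only [map_one, one_mul]
  generalize (X : R⟦X⟧) ^ tri (k - 1) = T1 at *
  generalize (X : R⟦X⟧) ^ tri (k + 1) = T2 at *
  generalize (C (((-x) ^ (k - 1) : Rˣ) : R) : R⟦X⟧) = d1 at *
  generalize (C (((-x) ^ (k + 1) : Rˣ) : R) : R⟦X⟧) = d2 at *
  generalize (C (((-x) ^ k : Rˣ) : R) : R⟦X⟧) = d at *
  generalize (X : R⟦X⟧) ^ tri k = T at *
  rw [show 2 * M + 1 + 1 = 2 * M + 2 by ring]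
  generalize (X : R⟦X⟧) ^ (2 * M + 1) = p at *
  generalize (X : R⟦X⟧) ^ (2 * M + 2) = p' at *
  generalize (C (x : R) : R⟦X⟧) = cx at *
  generalize (C ((x⁻¹ : Rˣ) : R) : R⟦X⟧) = cx' at *
  linear_combination (d * T * finPoch 1 (2 * M)) * key
    + d * (finPoch 1 (2 * M) * recipPoch R (u - 2) * recipPoch R v) * e1' * (-1)
    + d * (finPoch 1 (2 * M) * recipPoch R u * recipPoch R (v - 2)) * e2' * (-1)
    + X ^ M * T1 * (finPoch 1 (2 * M) * recipPoch R (u - 2) * recipPoch R v) * c1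
    + X ^ (M + 1) * T2 * (finPoch 1 (2 * M) * recipPoch R u * recipPoch R (v - 2)) * c2

variable [TopologicalSpace R] [IsTopologicalRing R]

lemma hasSum_finTerm (x : Rˣ) (M : ℕ) :
    HasSum (finTerm x M)
      (∏ i ∈ range M, ((1 - C (x : R) * X ^ i) * (1 - C ((x⁻¹ : Rˣ) : R) * X ^ (i + 1)))) := by
  induction M with
  | zero =>
    convert hasSum_single (f := finTerm x 0) 0 fun k hk ↦ finTerm_of_lt x (by simpa using hk)
    simp [finTerm, tri, recipPoch_zero]
  | succ M ih =>
    have h1 := ((Equiv.subRight (1 : ℤ)).hasSum_iff).mpr ih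
    have h2 := ((Equiv.addRight (1 : ℤ)).hasSum_iff).mpr ih
    have := ((ih.mul_left (1 + X ^ (2 * M + 1))).add
      (h1.mul_left (-(C (x : R) * X ^ M)))).add (h2.mul_left (-(C ((x⁻¹ : Rˣ) : R) * X ^ (M + 1))))
    have hx : (C (x : R) : R⟦X⟧) * C ((x⁻¹ : Rˣ) : R) = 1 := by
      rw [← map_mul]; simp
    rw [funext (finTerm_succ x M), prod_range_succ]
    refine (congrArg (HasSum _) ?_).mp this
    linear_combination (-X ^ M * X ^ (M + 1) *
      (∏ i ∈ range M, ((1 - C (x : R) * X ^ i) * (1 - C ((x⁻¹ : Rˣ) : R) * X ^ (i + 1))))) * hx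

/-- The `k`-th term of the theta series of `x`. -/
noncomputable def thetaTerm (x : Rˣ) (k : ℤ) : R⟦X⟧ := C (((-x) ^ k : Rˣ) : R) * X ^ tri k

variable [T2Space R]

omit [IsTopologicalRing R] in
lemma X_pow_dvd_finTerm_sub (x : Rˣ) {N M : ℕ} (h : 2 * N + 2 ≤ M) (k : ℤ) :
    X ^ N ∣ finTerm x M k * infPoch 1 - thetaTerm x k := by
  rw [thetaTerm, finTerm, mul_assoc, ← mul_sub_one]
  rcases le_or_gt (N : ℤ) (tri k) with hk | hk
  · exact ((pow_dvd_pow _ (by omega)).mul_left _).mul_right _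
  refine Dvd.dvd.mul_left ?_ _
  have hb : |k| ≤ N := by have := abs_le_tri k; omega
  obtain ⟨hl, hr⟩ := abs_le.mp hb
  obtain ⟨u, hu⟩ := Int.eq_ofNat_of_zero_le (a := M + k) (by omega)
  obtain ⟨v, hv⟩ := Int.eq_ofNat_of_zero_le (a := M - k) (by omega)
  rw [hu, hv]
  have d1 := X_pow_dvd_infPoch_sub (1 : R) (N := N) (n := u) (by omega)
  have d2 := X_pow_dvd_infPoch_sub (1 : R) (N := N) (n := v) (by omega)
  have d3 := X_pow_dvd_infPoch_sub (1 : R) (N := N) (n := 2 * M) (by omega)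
  have hu' := finPoch_mul_recipPoch (R := R) u
  have hv' := finPoch_mul_recipPoch (R := R) v
  convert dvd_add (dvd_add (d1.mul_left (finPoch 1 v * recipPoch R u * recipPoch R v))
    ((dvd_sub d2 d3).mul_left (infPoch 1 * recipPoch R u * recipPoch R v))) (dvd_zero _) using 1
  linear_combination hu' + finPoch 1 u * recipPoch R u * hv'

/-- **Jacobi's triple product identity**. -/
theorem hasSum_thetaTerm (x : Rˣ) :
    HasSum (thetaTerm x)
      ((1 - C (x : R)) * infPoch (x : R) * infPoch ((x⁻¹ : Rˣ) : R) * infPoch 1) := by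
  rw [hasSum_iff_hasSum_coeff]
  intro d
  have h := ((hasSum_finTerm x (2 * (d + 1) + 3)).mul_right (infPoch 1))
  rw [hasSum_iff_hasSum_coeff] at h
  convert h d using 1
  · funext k
    have := X_pow_dvd_finTerm_sub x (show 2 * (d + 1) + 2 ≤ 2 * (d + 1) + 3 by omega) k
    rw [X_pow_dvd_iff] at this
    have := this d (by omega)
    rw [map_sub, sub_eq_zero] at this
    exact this.symm
  · have e : ∏ i ∈ range (2 * (d + 1) + 3),
        ((1 - C (x : R) * X ^ i) * (1 - C ((x⁻¹ : Rˣ) : R) * X ^ (i + 1)))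
        = (1 - C (x : R)) * finPoch (x : R) (2 * (d + 1) + 2)
          * finPoch ((x⁻¹ : Rˣ) : R) (2 * (d + 1) + 3) := by
      rw [prod_mul_distrib, prod_range_succ']
      simp only [finPoch, pow_zero, mul_one]
      ring
    rw [e]
    have d1 := X_pow_dvd_infPoch_sub (x : R) (N := d + 1) (n := 2 * (d + 1) + 2) (by omega)
    have d2 := X_pow_dvd_infPoch_sub ((x⁻¹ : Rˣ) : R) (N := d + 1) (n := 2 * (d + 1) + 3)
      (by omega)
    have d3 := dvd_add (d1.mul_left ((1 - C (x : R)) * infPoch ((x⁻¹ : Rˣ) : R) * infPoch 1))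
      (d2.mul_left ((1 - C (x : R)) * finPoch (x : R) (2 * (d + 1) + 2) * infPoch 1))
    have := X_pow_dvd_iff.mp d3 d (by omega)
    rw [← sub_eq_zero, ← map_sub, ← this]
    congr 1
    ring

end TripleProduct

section MonoSum
variable {R : Type*} [CommRing R] [TopologicalSpace R]

/-- `f` is the sum of the monomials `c i * X ^ e i`, each exponent occurring finitely often. -/
structure IsMonoSum {ι : Type*} (c : ι → R) (e : ι → ℕ) (f : R⟦X⟧) : Prop where
  finite : ∀ n, {i | e i = n}.Finite
  hasSum : HasSum (fun i ↦ C (c i) * X ^ e i) f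

namespace IsMonoSum
variable {ι κ : Type*} {c c' : ι → R} {e : ι → ℕ} {f g : R⟦X⟧} {d : κ → R} {e' : κ → ℕ}

lemma reindex (h : IsMonoSum c e f) (σ : κ ≃ ι) (hc : ∀ k, c (σ k) = d k)
    (he : ∀ k, e (σ k) = e' k) : IsMonoSum d e' f := by
  refine ⟨fun n ↦ ?_, ?_⟩
  · refine ((h.finite n).preimage σ.injective.injOn).subset fun k hk ↦ ?_
    simpa [he] using hk
  · have := (Equiv.hasSum_iff σ).mpr h.hasSum
    simpa only [Function.comp_def, hc, he] using this

lemma unique [T2Space R] (h : IsMonoSum c e f) (h' : IsMonoSum c e g) : f = g :=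
  h.hasSum.unique h'.hasSum

lemma coeff_eq_sum [T2Space R] (h : IsMonoSum c e f) (n : ℕ) :
    coeff n f = ∑ i ∈ (h.finite n).toFinset, c i := by
  have := (hasSum_iff_hasSum_coeff R).mp h.hasSum n
  refine this.unique ?_
  refine (congrArg (HasSum _) ?_).mp
    (hasSum_sum_of_ne_finset_zero (s := (h.finite n).toFinset) fun i hi ↦ ?_)
  · refine sum_congr rfl fun i hi ↦ ?_
    rw [Set.Finite.mem_toFinset, Set.mem_ofPred_eq] at hi
    rw [coeff_C_mul_X_pow, if_pos hi.symm]
  · rw [Set.Finite.mem_toFinset, Set.mem_ofPred_eq] at hi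
    rw [coeff_C_mul_X_pow, if_neg fun h ↦ hi h.symm]

variable [IsTopologicalRing R]

lemma add (h : IsMonoSum c e f) (h' : IsMonoSum c' e g) :
    IsMonoSum (fun i ↦ c i + c' i) e (f + g) := by
  refine ⟨h.finite, ?_⟩
  simpa only [map_add, add_mul] using h.hasSum.add h'.hasSum

lemma sub (h : IsMonoSum c e f) (h' : IsMonoSum c' e g) :
    IsMonoSum (fun i ↦ c i - c' i) e (f - g) := by
  refine ⟨h.finite, ?_⟩
  simpa only [map_sub, sub_mul] using h.hasSum.sub h'.hasSum

lemma neg (h : IsMonoSum c e f) : IsMonoSum (fun i ↦ - c i) e (-f) := by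
  refine ⟨h.finite, ?_⟩
  simpa only [map_neg, neg_mul] using h.hasSum.neg

lemma X_mul (h : IsMonoSum c e f) : IsMonoSum c (fun i ↦ e i + 1) (X * f) := by
  refine ⟨fun n ↦ ?_, ?_⟩
  · refine (h.finite (n - 1)).subset fun i hi ↦ ?_
    rw [Set.mem_ofPred_eq] at hi ⊢
    omega
  · have := h.hasSum.mul_left X
    rw [funext fun i ↦ show C (c i) * (X : R⟦X⟧) ^ (e i + 1) = X * (C (c i) * X ^ e i) by ring]
    exact this

variable [T2Space R]

lemma mul (h : IsMonoSum c e f) (h' : IsMonoSum d e' g) :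
    IsMonoSum (fun p : ι × κ ↦ c p.1 * d p.2) (fun p ↦ e p.1 + e' p.2) (f * g) := by
  have hfin : ∀ n, {p : ι × κ | e p.1 + e' p.2 = n}.Finite := fun n ↦ by
    refine (Set.Finite.biUnion (finite_toSet (antidiagonal n)) fun q _ ↦
      (h.finite q.1).prod (h'.finite q.2)).subset fun p hp ↦ ?_
    rw [Set.mem_ofPred_eq] at hp
    refine Set.mem_biUnion (x := (e p.1, e' p.2)) ?_ ?_
    · rw [mem_coe, HasAntidiagonal.mem_antidiagonal]
      exact hp
    · rw [Set.mem_prod]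
      exact ⟨Set.mem_ofPred_eq ▸ rfl, Set.mem_ofPred_eq ▸ rfl⟩
  refine ⟨hfin, ?_⟩
  have hs := summable_C_mul_X_pow hfin fun p ↦ c p.1 * d p.2
  rw [funext fun p : ι × κ ↦ show C (c p.1 * d p.2) * (X : R⟦X⟧) ^ (e p.1 + e' p.2)
    = C (c p.1) * X ^ e p.1 * (C (d p.2) * X ^ e' p.2) by rw [map_mul, pow_add]; ring] at hs ⊢
  have : T3Space R⟦X⟧ := inferInstance
  have : IsTopologicalSemiring R⟦X⟧ := inferInstance
  exact HasSum.mul (α := R⟦X⟧) (f := fun i ↦ C (c i) * X ^ e i) (g := fun k ↦ C (d k) * X ^ e' k)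
    h.hasSum h'.hasSum hs

omit [IsTopologicalRing R] [T2Space R] in
lemma expand (h : IsMonoSum c e f) {p : ℕ} (hp : p ≠ 0) :
    IsMonoSum c (fun i ↦ p * e i) (PowerSeries.expand p hp f) := by
  refine ⟨fun n ↦ ?_, ?_⟩
  · refine (h.finite (n / p)).subset fun i hi ↦ ?_
    rw [Set.mem_ofPred_eq] at hi ⊢
    rw [← hi, Nat.mul_div_cancel_left _ (Nat.pos_of_ne_zero hp)]
  · rw [hasSum_iff_hasSum_coeff]
    intro m
    have e1 : ∀ i, C (c i) * (X : R⟦X⟧) ^ (p * e i)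
        = PowerSeries.expand p hp (C (c i) * X ^ e i) := fun i ↦ by
      rw [map_mul, expand_C, map_pow, expand_X, ← pow_mul]
    simp only [e1]
    by_cases hm : p ∣ m
    · obtain ⟨k, rfl⟩ := hm
      simp only [coeff_expand_mul]
      exact (hasSum_iff_hasSum_coeff R).mp h.hasSum k
    · simp only [coeff_expand_of_not_dvd p hp _ hm]
      exact hasSum_zero

end IsMonoSum
end MonoSum

section Winquist
variable {R : Type*} [CommRing R]

lemma tri_one_sub (t : ℤ) : tri (1 - t) = tri t := by
  zify
  linarith [two_mul_tri (1 - t), two_mul_tri t]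

lemma finite_fiber_tri_progression (c : ℤ) (m : ℕ) : {k : ℤ | tri (3 * k + c) = m}.Finite := by
  refine ((finite_fiber_of_abs_le abs_le_tri m).preimage
    (f := fun k : ℤ ↦ 3 * k + c) fun a _ b _ h ↦ ?_).subset fun k hk ↦ hk
  simp only at h
  omega

lemma neg_one_zpow_one_sub (t : ℤ) : (-1 : Rˣ) ^ (1 - t) = -(-1) ^ t := by
  rw [zpow_sub, zpow_one, ← inv_zpow]
  simp

variable [TopologicalSpace R]

/-- The part of the theta series of `x` over one residue class modulo `3`, with shifted exponents. -/
noncomputable def thetaPart (x : Rˣ) (c s : ℤ) : R⟦X⟧ :=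
  ∑' n : ℤ, C (((-x) ^ (3 * n + c) : Rˣ) : R) * X ^ tri (3 * n + (c + s))

variable [T2Space R]

omit [T2Space R] in
lemma isMonoSum_thetaPart (x : Rˣ) (c s : ℤ) :
    IsMonoSum (fun n : ℤ ↦ (((-x) ^ (3 * n + c) : Rˣ) : R)) (fun n ↦ tri (3 * n + (c + s)))
      (thetaPart x c s) :=
  ⟨finite_fiber_tri_progression _, (summable_C_mul_X_pow (finite_fiber_tri_progression _) _).hasSum⟩

omit [T2Space R] in
lemma isMonoSum_thetaPart' {x : Rˣ} {c s : ℤ} {σ : ℤ ≃ ℤ} {u : ℤ → Rˣ} {e : ℤ → ℕ}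
    (hu : ∀ n, (-x) ^ (3 * σ n + c) = u n) (he : ∀ n, tri (3 * σ n + (c + s)) = e n) :
    IsMonoSum (fun n : ℤ ↦ (u n : R)) e (thetaPart x c s) :=
  (isMonoSum_thetaPart x c s).reindex σ (fun n ↦ by rw [hu]) he

lemma thetaPart_add_three (x : Rˣ) (c s : ℤ) : thetaPart x (c + 3) s = thetaPart x c s := by
  refine (isMonoSum_thetaPart' (x := x) (σ := Equiv.subRight 1) (fun n ↦ ?_) fun n ↦ ?_).unique
    (isMonoSum_thetaPart x c s)
  · congr 1
    simp only [Equiv.subRight_apply]; ring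
  · congr 1
    simp only [Equiv.subRight_apply]; ring

variable [IsTopologicalRing R]

lemma thetaPart_one_sub (c : ℤ) : thetaPart (1 : Rˣ) (1 - c) 0 = -thetaPart (1 : Rˣ) c 0 := by
  refine ((isMonoSum_thetaPart' (σ := Equiv.neg ℤ) (u := fun n ↦ -(-1) ^ (3 * n + c))
    (e := fun n ↦ tri (3 * n + (c + 0))) (fun n ↦ ?_) fun n ↦ ?_)).unique ?_
  · rw [← neg_one_zpow_one_sub]
    congr 1
    simp only [Equiv.neg_apply]; ring
  · rw [← tri_one_sub]
    congr 1
    simp only [Equiv.neg_apply]; ring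
  · simpa using (isMonoSum_thetaPart (1 : Rˣ) c 0).neg

lemma isMonoSum_thetaTerm (x : Rˣ) :
    IsMonoSum (fun k : ℤ ↦ (((-x) ^ k : Rˣ) : R)) tri
      ((1 - C (x : R)) * infPoch (x : R) * infPoch ((x⁻¹ : Rˣ) : R) * infPoch 1) :=
  ⟨finite_fiber_of_abs_le abs_le_tri, hasSum_thetaTerm x⟩

omit [IsTopologicalRing R] in
lemma thetaPart_one_zero :
    thetaPart (1 : Rˣ) 0 0 = PowerSeries.expand 3 three_ne_zero (infPoch (1 : R)) := by
  have h : IsMonoSum (fun k : ℤ ↦ (((-1) ^ k : Rˣ) : R)) pentagonal (infPoch (1 : R)) := by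
    refine ⟨fun n ↦ Set.Subsingleton.finite fun a ha b hb ↦ ?_, ?_⟩
    · rw [Set.mem_ofPred_eq] at ha hb
      exact pentagonal_injective (ha.trans hb.symm)
    · have := hasSum_pentagonalSeries R
      rw [← tprod_one_sub_X_pow R] at this
      have e : ∀ k : ℤ, C (((-1) ^ k : Rˣ) : R) = (Int.negOnePow k : R⟦X⟧) := fun k ↦ by
        rcases Int.even_or_odd k with hk | hk <;> simp [Int.negOnePow, hk.neg_one_zpow]
      simpa [infPoch, e] using this
  refine (isMonoSum_thetaPart _ _ _).unique ((h.expand three_ne_zero).reindex (Equiv.refl ℤ)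
    (fun k ↦ ?_) fun k ↦ ?_)
  · rw [add_zero, zpow_mul, Equiv.refl_apply, Odd.neg_one_zpow (n := 3) (by decide)]
  · have h1 := two_mul_natCast_pentagonal k
    have h2 := two_mul_tri (3 * k + (0 + 0))
    simp only [Equiv.refl_apply]
    zify
    linarith

/-- The change of variables behind Winquist's identity: integer quadruples are parametrised by
two residues modulo `3` together with four integers. -/
noncomputable def winquistEquiv : (Fin 3 × Fin 3) × ((ℤ × ℤ) × (ℤ × ℤ)) ≃ (ℤ × ℤ) × (ℤ × ℤ) :=
  Equiv.ofBijective (fun p ↦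
    ((p.2.1.1 + p.2.2.1 - p.2.2.2 + p.1.1.val, p.2.1.2 + p.2.2.1 + p.2.2.2 + p.1.2.val),
      (p.2.1.1 + p.2.1.2 - p.2.2.1, p.2.1.1 - p.2.1.2 + p.2.2.2))) <| by
    constructor
    · rintro ⟨⟨i, j⟩, ⟨x, y⟩, z, w⟩ ⟨⟨i', j'⟩, ⟨x', y'⟩, z', w'⟩ h
      simp only [Prod.mk.injEq] at h ⊢
      have := i.isLt; have := j.isLt; have := i'.isLt; have := j'.isLt
      rw [Fin.ext_iff, Fin.ext_iff]
      omega
    · rintro ⟨⟨k, l⟩, m, n⟩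
      refine ⟨⟨⟨⟨((k + m + n) % 3).toNat, by omega⟩, ⟨((l + m - n) % 3).toNat, by omega⟩⟩,
        ⟨(k + m + n) / 3, (l + m - n) / 3⟩,
        ⟨(k + m + n) / 3 + (l + m - n) / 3 - m, n - (k + m + n) / 3 + (l + m - n) / 3⟩⟩, ?_⟩
      simp only [Prod.mk.injEq]
      omega

lemma zpow_mul_zpow_mul {G : Type*} [CommGroup G] (a b c : G) (k l m n : ℤ) :
    a ^ k * b ^ l * ((c * a * b) ^ m * (c * a * b⁻¹) ^ n)
      = a ^ (k + m + n) * b ^ (l + m - n) * (c ^ m * c ^ n) := by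
  simp only [mul_zpow, inv_zpow, zpow_add, zpow_sub]
  simp only [mul_comm, mul_left_comm, mul_assoc]

omit [TopologicalSpace R] [T2Space R] [IsTopologicalRing R] in
lemma winquist_coeff (a b : Rˣ) (x y z w i j : ℤ) :
    (-a) ^ (x + z - w + i) * (-b) ^ (y + z + w + j)
        * ((-(a * b)) ^ (x + y - z) * (-(a * b⁻¹)) ^ (x - y + w))
      = (-a) ^ (3 * x + i) * (-b) ^ (3 * y + j)
        * ((-1) ^ (3 * z + (i + j)) * (-1) ^ (3 * w + (j - i))) := by
  have h1 : -(a * b) = -1 * (-a) * (-b) := by simp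
  have h2 : -(a * b⁻¹) = -1 * (-a) * (-b)⁻¹ := by simp [inv_neg]
  have h3 : ((-1 : Rˣ)) ^ (2 * (2 * z + w + j - x)) = 1 := by
    rw [zpow_mul]
    simp
  rw [h1, h2]
  rw [zpow_mul_zpow_mul, ← zpow_add (-1 : Rˣ), ← zpow_add (-1 : Rˣ),
    show 3 * z + (i + j) + (3 * w + (j - i))
      = (x + y - z) + (x - y + w) + 2 * (2 * z + w + j - x) by ring, zpow_add (-1 : Rˣ) _ (2 * _),
    h3, mul_one]
  congr 3 <;> ring

lemma winquist_exponent (x y z w i j : ℤ) :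
    3 * ((tri (x + z - w + i) + tri (y + z + w + j)) + (tri (x + y - z) + tri (x - y + w))) + 1
      = (tri (3 * x + (i + -1)) + tri (3 * y + (j + 0)))
        + (tri (3 * z + (i + j + 0)) + tri (3 * w + (j - i + 0))) := by
  have h1 := two_mul_tri (x + z - w + i)
  have h2 := two_mul_tri (y + z + w + j)
  have h3 := two_mul_tri (x + y - z)
  have h4 := two_mul_tri (x - y + w)
  have h5 := two_mul_tri (3 * x + (i + -1))
  have h6 := two_mul_tri (3 * y + (j + 0))
  have h7 := two_mul_tri (3 * z + (i + j + 0))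
  have h8 := two_mul_tri (3 * w + (j - i + 0))
  zify
  refine mul_left_cancel₀ (two_ne_zero (α := ℤ)) ?_
  linear_combination 3 * (h1 + h2 + h3 + h4) - h5 - h6 - h7 - h8

/-- The product in the triple product identity. -/
noncomputable def thetaProd (x : Rˣ) : R⟦X⟧ :=
  (1 - C (x : R)) * infPoch (x : R) * infPoch ((x⁻¹ : Rˣ) : R)

lemma winquist_expand (a b : Rˣ) :
    X * PowerSeries.expand 3 three_ne_zero
        (thetaProd a * infPoch 1 * (thetaProd b * infPoch 1)
          * (thetaProd (a * b) * infPoch 1 * (thetaProd (a * b⁻¹) * infPoch 1)))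
      = ∑ p : Fin 3 × Fin 3, thetaPart a p.1.val (-1) * thetaPart b p.2.val 0
          * (thetaPart 1 (p.1.val + p.2.val) 0 * thetaPart 1 (p.2.val - p.1.val) 0) := by
  have h := (((((isMonoSum_thetaTerm a).mul (isMonoSum_thetaTerm b)).mul
    ((isMonoSum_thetaTerm (a * b)).mul (isMonoSum_thetaTerm (a * b⁻¹)))).expand
      three_ne_zero).X_mul).reindex winquistEquiv (fun _ ↦ rfl) (fun _ ↦ rfl)
  have h' := h.hasSum.prod_fiberwise fun p ↦
    (((((isMonoSum_thetaPart a p.1.val (-1)).mul (isMonoSum_thetaPart b p.2.val 0)).mul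
      ((isMonoSum_thetaPart 1 (p.1.val + p.2.val) 0).mul
        (isMonoSum_thetaPart 1 (p.2.val - p.1.val) 0))).reindex (Equiv.refl _)
          (fun q ↦ ?_) fun q ↦ ?_).hasSum)
  · exact h'.unique (hasSum_fintype _)
  · exact (congrArg Units.val (winquist_coeff a b q.1.1 q.1.2 q.2.1 q.2.2 p.1.val p.2.val)).symm
  · exact (winquist_exponent q.1.1 q.1.2 q.2.1 q.2.2 p.1.val p.2.val).symm

/-- The coefficients of Winquist's double series. -/
def winquistCoeff (a b : Rˣ) (x y : ℤ) : R :=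
  (((-a) ^ (3 * y + 3) : Rˣ) + ((-a) ^ (-3 * y) : Rˣ))
      * (((-b) ^ (3 * x) : Rˣ) + ((-b) ^ (1 - 3 * x) : Rˣ))
    - (((-a) ^ (3 * x + 1) : Rˣ) + ((-a) ^ (2 - 3 * x) : Rˣ))
      * (((-b) ^ (3 * y + 2) : Rˣ) + ((-b) ^ (-3 * y - 1) : Rˣ))

lemma isMonoSum_winquist_fold (a b : Rˣ) :
    IsMonoSum (fun p : ℤ × ℤ ↦ winquistCoeff a b p.1 p.2) (fun p ↦ tri (3 * p.1) + tri (3 * p.2 + 2))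
      (2 * (thetaPart a 0 (-1) * (thetaPart b 0 0 + thetaPart b 1 0)
        - (thetaPart a 1 (-1) + thetaPart a 2 (-1)) * thetaPart b 2 0)) := by
  have hA : IsMonoSum (fun p : ℤ ↦ (((-b) ^ (3 * p) : Rˣ) : R) + ((-b) ^ (1 - 3 * p) : Rˣ))
      (fun p ↦ tri (3 * p)) (thetaPart b 0 0 + thetaPart b 1 0) := by
    refine (isMonoSum_thetaPart' (σ := Equiv.refl ℤ) (fun n ↦ ?_) fun n ↦ ?_).add
      (isMonoSum_thetaPart' (σ := Equiv.neg ℤ) (fun n ↦ ?_) fun n ↦ ?_)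
    · congr 1; simp
    · congr 1; simp
    · congr 1; simp; ring
    · rw [← tri_one_sub]; congr 1; simp
  have hD : IsMonoSum (fun p : ℤ ↦ (((-b) ^ (3 * p + 2) : Rˣ) : R) + ((-b) ^ (-3 * p - 1) : Rˣ))
      (fun p ↦ tri (3 * p + 2)) (thetaPart b 2 0 + thetaPart b 2 0) := by
    refine (isMonoSum_thetaPart' (σ := Equiv.refl ℤ) (fun n ↦ ?_) fun n ↦ ?_).add
      (isMonoSum_thetaPart' (σ := Equiv.subLeft (-1)) (fun n ↦ ?_) fun n ↦ ?_)
    · congr 1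
    · congr 1
    · congr 1; simp; ring
    · rw [← tri_one_sub]; congr 1; simp; ring
  have hB : IsMonoSum (fun p : ℤ ↦ (((-a) ^ (3 * p + 1) : Rˣ) : R) + ((-a) ^ (2 - 3 * p) : Rˣ))
      (fun p ↦ tri (3 * p)) (thetaPart a 1 (-1) + thetaPart a 2 (-1)) := by
    refine (isMonoSum_thetaPart' (σ := Equiv.refl ℤ) (fun n ↦ ?_) fun n ↦ ?_).add
      (isMonoSum_thetaPart' (σ := Equiv.neg ℤ) (fun n ↦ ?_) fun n ↦ ?_)
    · congr 1
    · congr 1; simp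
    · congr 1; simp; ring
    · rw [← tri_one_sub]; congr 1; simp
  have hC : IsMonoSum (fun p : ℤ ↦ (((-a) ^ (3 * p + 3) : Rˣ) : R) + ((-a) ^ (-3 * p) : Rˣ))
      (fun p ↦ tri (3 * p + 2)) (thetaPart a 0 (-1) + thetaPart a 0 (-1)) := by
    refine (isMonoSum_thetaPart' (σ := Equiv.addRight 1) (fun n ↦ ?_) fun n ↦ ?_).add
      (isMonoSum_thetaPart' (σ := Equiv.neg ℤ) (fun n ↦ ?_) fun n ↦ ?_)
    · congr 1; simp; ring
    · congr 1; simp; ring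
    · congr 1; simp
    · rw [← tri_one_sub]; congr 1; simp; ring
  have h := ((hC.mul hA).reindex (Equiv.prodComm ℤ ℤ) (fun _ ↦ rfl)
    (fun p ↦ Nat.add_comm _ _)).sub (hB.mul hD)
  rw [show ∀ u v w t : R⟦X⟧, 2 * (u * v - w * t) = (u + u) * v - w * (t + t) by intros; ring]
  exact h

variable [IsDomain R] [CharZero R]

lemma thetaPart_one_two : thetaPart (1 : Rˣ) 2 0 = 0 := by
  have h := thetaPart_one_sub (R := R) 2
  rw [← thetaPart_add_three] at h
  norm_num at h
  have h2 : (2 : R⟦X⟧) * thetaPart (1 : Rˣ) 2 0 = 0 := by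
    rw [two_mul]
    nth_rw 1 [h]
    simp
  have h3 : (2 : R⟦X⟧) ≠ 0 := by
    intro h0
    have := congrArg (constantCoeff (R := R)) h0
    rw [map_ofNat, map_zero] at this
    exact two_ne_zero this
  exact (mul_eq_zero.mp h2).resolve_left h3

/-- **Winquist's identity**. -/
theorem isMonoSum_winquist (a b : Rˣ) :
    IsMonoSum (fun p : ℤ × ℤ ↦ winquistCoeff a b p.1 p.2) (fun p ↦ tri (3 * p.1) + tri (3 * p.2 + 2))
      (2 * (X * PowerSeries.expand 3 three_ne_zero (thetaProd a * thetaProd b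
        * thetaProd (a * b) * thetaProd (a * b⁻¹) * infPoch 1 ^ 2))) := by
  have hK : PowerSeries.expand 3 three_ne_zero (infPoch (1 : R)) ≠ 0 := by
    intro h0
    have := congrArg (constantCoeff (R := R)) h0
    rw [constantCoeff_expand, constantCoeff_infPoch] at this
    simp at this
  have h := winquist_expand a b
  have k1 := thetaPart_one_sub (R := R) 0
  have k2 := thetaPart_one_two (R := R)
  have k3 := thetaPart_add_three (1 : Rˣ) 0 0
  have k4 := thetaPart_add_three (1 : Rˣ) 1 0
  have km1 := thetaPart_add_three (1 : Rˣ) (-1) 0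
  have km2 := thetaPart_add_three (1 : Rˣ) (-2) 0
  norm_num at k1 k3 k4 km1 km2
  rw [Fintype.sum_prod_type] at h
  simp only [Fin.sum_univ_three] at h
  norm_num [k1, k2, k3, k4, ← km1, ← km2] at h
  rw [thetaPart_one_zero] at h
  convert isMonoSum_winquist_fold a b using 2
  refine mul_left_cancel₀ (pow_ne_zero 2 hK) ?_
  simp only [map_mul, map_pow] at h ⊢
  linear_combination h

end Winquist

section QBinomial
variable {R : Type*} [CommRing R]

/-- The `j`-th term of the `q`-binomial series with argument `t q ^ m`. -/
noncomputable def qBinomTerm (a t : R) (m j : ℕ) : R⟦X⟧ :=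
  finPoch a j * recipPoch R j * (C t * X ^ m) ^ j

lemma qBinomTerm_zero (a t : R) (m : ℕ) : qBinomTerm a t m 0 = 1 := by
  simp [qBinomTerm, recipPoch_zero]

lemma qBinomTerm_succ (a t : R) (m j : ℕ) :
    qBinomTerm a t m (j + 1) - qBinomTerm a t (m + 1) (j + 1)
      = C t * X ^ m * qBinomTerm a t m j
        - C (a * t) * X ^ (m + 1) * qBinomTerm a t (m + 1) j := by
  have h := one_sub_mul_recipPoch (R := R) (j + 1)
  push_cast at h
  rw [add_sub_cancel_right] at h
  simp only [qBinomTerm, finPoch_succ, map_mul]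
  push_cast
  rw [← h]
  ring

lemma X_pow_dvd_qBinomTerm (a t : R) (m j : ℕ) : X ^ (m * j) ∣ qBinomTerm a t m j := by
  rw [qBinomTerm, mul_pow, ← pow_mul]
  exact ((dvd_refl _).mul_left _).mul_left _

variable [TopologicalSpace R]

lemma summable_of_X_pow_dvd {u : ℕ → R⟦X⟧} (h : ∀ j, X ^ j ∣ u j) : Summable u := by
  rw [summable_iff_summable_coeff]
  intro d
  refine summable_of_hasFiniteSupport ((Set.finite_Iic d).subset fun i hi ↦ ?_)
  by_contra hd
  exact hi (X_pow_dvd_iff.mp (h i) d (by simpa using hd))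

variable [T2Space R]

lemma X_pow_dvd_of_hasSum {ι : Type*} {u : ι → R⟦X⟧} {f : R⟦X⟧} {N : ℕ} (hf : HasSum u f)
    (h : ∀ j, X ^ N ∣ u j) : X ^ N ∣ f := by
  rw [X_pow_dvd_iff]
  intro d hd
  refine ((hasSum_iff_hasSum_coeff R).mp hf d).unique ?_
  rw [funext fun j ↦ X_pow_dvd_iff.mp (h j) d hd]
  exact hasSum_zero

variable [IsTopologicalRing R]

lemma exists_hasSum_qBinomTerm (a t : R) :
    ∃ f : R⟦X⟧, HasSum (qBinomTerm a t 1) f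
      ∧ (1 - C (a * t) * X) * f * infPoch t = infPoch (a * t) := by
  have hs : ∀ m, ∃ f : R⟦X⟧, HasSum (qBinomTerm a t (m + 1)) f := fun m ↦
    (summable_of_X_pow_dvd fun j ↦ (pow_dvd_pow X (by nlinarith)).trans
      (X_pow_dvd_qBinomTerm a t (m + 1) j))
  choose f hf using hs
  have hf' : ∀ m, HasSum (fun j ↦ qBinomTerm a t (m + 1) (j + 1)) (f m - 1) := fun m ↦ by
    simpa [qBinomTerm_zero] using (hasSum_nat_add_iff' 1).mpr (hf m)
  have hrec : ∀ m, (1 - C t * X ^ (m + 1)) * f m = (1 - C (a * t) * X ^ (m + 2)) * f (m + 1) := by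
    intro m
    have h1 := (hf' m).sub (hf' (m + 1))
    rw [funext fun j ↦ qBinomTerm_succ a t (m + 1) j] at h1
    have := h1.unique (((hf m).mul_left _).sub ((hf (m + 1)).mul_left _))
    linear_combination this
  have hone : ∀ m, X ^ (m + 1) ∣ f m - 1 := fun m ↦ X_pow_dvd_of_hasSum (hf' m) fun j ↦
    (pow_dvd_pow X (by nlinarith)).trans (X_pow_dvd_qBinomTerm a t (m + 1) (j + 1))
  have hfin : ∀ n, (1 - C (a * t) * X) * f 0 * finPoch t n = finPoch (a * t) (n + 1) * f n := by
    intro n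
    induction n with
    | zero => simp [finPoch]
    | succ n ih =>
      rw [finPoch_succ t, finPoch_succ _ (n + 1), ← mul_assoc, ih]
      linear_combination finPoch (a * t) (n + 1) * hrec n
  refine ⟨f 0, hf 0, ?_⟩
  rw [← sub_eq_zero]
  ext d
  have d1 := (X_pow_dvd_infPoch_sub t (le_refl (d + 1))).mul_left ((1 - C (a * t) * X) * f 0)
  have d2 := X_pow_dvd_infPoch_sub (a * t) (Nat.le_succ (d + 1))
  have d3 := (hone (d + 1)).mul_left (finPoch (a * t) (d + 1 + 1))
  have d4 := dvd_add (dvd_sub d1 d2) ((pow_dvd_pow X (Nat.le_succ (d + 1))).trans d3)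
  have := X_pow_dvd_iff.mp d4 d (by omega)
  rw [map_zero, ← this]
  congr 1
  linear_combination hfin (d + 1)

end QBinomial

section CrankSeries
variable {R : Type*} [CommRing R]

/-- The character on parts weighting `m` ones by `e m` and each part larger than `j` by `z`. -/
def partWeight (e : ℕ → R) (z : R) (j i m : ℕ) : R :=
  if i = 1 then e m else (if j < i then z else 1) ^ m

lemma prod_map_ite_eq_pow_card (z : R) (p : ℕ → Prop) [DecidablePred p] (s : Multiset ℕ) :
    (s.map fun i ↦ if p i then z else 1).prod = z ^ (s.filter p).card := by
  induction s using Multiset.induction with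
  | empty => simp
  | cons a s ih =>
    by_cases h : p a <;> simp [h, ih, pow_succ']

lemma toFinsupp_prod_partWeight (e : ℕ → R) (z : R) {j : ℕ} (hj : 1 ≤ j) (s : Multiset ℕ) :
    s.toFinsupp.prod (partWeight e z j)
      = (if s.count 1 = 0 then 1 else e (s.count 1)) * z ^ (s.filter (j < ·)).card := by
  rw [← prod_map_ite_eq_pow_card, prod_multiset_map_count, Finsupp.prod,
    Multiset.toFinsupp_support]
  have h : ∀ i ∈ s.toFinset, partWeight e z j i (s.toFinsupp i)
      = (if i = 1 then e (s.count i) else 1) * (if j < i then z else 1) ^ s.count i := by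
    intro i _
    rw [Multiset.toFinsupp_apply, partWeight]
    split_ifs with h1 h2 h2
    · omega
    · simp
    · simp
    · simp
  rw [prod_congr rfl h, prod_mul_distrib, prod_ite_eq']
  simp only [Multiset.mem_toFinset, ← Multiset.count_ne_zero, ite_not]

lemma coeff_genFun_partWeight (e : ℕ → R) (z : R) {j : ℕ} (hj : 1 ≤ j) (n : ℕ) :
    coeff n (Nat.Partition.genFun (partWeight e z j))
      = ∑ π : n.Partition, (if π.parts.count 1 = 0 then 1 else e (π.parts.count 1))
          * z ^ (π.parts.filter (j < ·)).card := by
  rw [Nat.Partition.coeff_genFun]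
  exact sum_congr rfl fun π _ ↦ toFinsupp_prod_partWeight e z hj π.parts

variable [TopologicalSpace R] [T2Space R] [IsTopologicalRing R]

lemma one_add_tsum_pow_mul (z : R) (i : ℕ) :
    (1 + ∑' m : ℕ, z ^ (m + 1) • (X : R⟦X⟧) ^ ((i + 1) * (m + 1))) * (1 - C z * X ^ (i + 1)) = 1 := by
  have hs := (Nat.Partition.summable_genFun_term (fun _ m ↦ z ^ m) i).hasSum
  have e : (fun m : ℕ ↦ z ^ (m + 1) • (X : R⟦X⟧) ^ ((i + 1) * (m + 1)))
      = fun m ↦ (C z * X ^ (i + 1)) ^ (m + 1) := by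
    funext m
    rw [smul_eq_C_mul, mul_pow, ← pow_mul, map_pow]
  simp only [e] at hs ⊢
  have h1 := (hasSum_nat_add_iff' 1).mpr hs
  have h2 := hs.mul_left (C z * X ^ (i + 1))
  simp only [← pow_succ', sum_range_one, zero_add, pow_one] at h1 h2
  have := h1.unique h2
  linear_combination this

lemma genFun_partWeight_zero (z : R) {j : ℕ} (hj : 1 ≤ j) :
    Nat.Partition.genFun (partWeight (fun _ ↦ 0) z j) * infPoch z
      = (1 - X) * recipPoch R j * finPoch z j := by
  have hP := Nat.Partition.hasProd_genFun (partWeight (fun _ ↦ (0 : R)) z j)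
  have hW := (multipliable_one_sub_C_mul_X_pow z).hasProd
  have hfin : ∀ x : R, HasProd (fun i ↦ if i < j then 1 - C x * X ^ (i + 1) else 1) (finPoch x j) :=
    fun x ↦ by
      have := hasProd_prod_of_ne_finset_one (L := .unconditional ℕ) (s := range j)
        (f := fun i ↦ if i < j then 1 - C x * (X : R⟦X⟧) ^ (i + 1) else 1)
        (fun i hi ↦ if_neg (by simpa using hi))
      rwa [prod_congr rfl fun i hi ↦ if_pos (by simpa using hi)] at this
  have h0 : HasProd (fun i : ℕ ↦ if i = 0 then 1 - (X : R⟦X⟧) else 1) (1 - X) := by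
    simpa using hasProd_ite_eq 0 (1 - (X : R⟦X⟧))
  have h1 := (hP.mul (hfin 1)).mul hW
  have h2 := h0.mul (hfin z)
  have heq : ∀ i : ℕ, (1 + ∑' m : ℕ, partWeight (fun _ ↦ (0 : R)) z j (i + 1) (m + 1) •
        (X : R⟦X⟧) ^ ((i + 1) * (m + 1)))
          * (if i < j then 1 - C 1 * X ^ (i + 1) else 1) * (1 - C z * X ^ (i + 1))
      = (if i = 0 then 1 - X else 1) * (if i < j then 1 - C z * X ^ (i + 1) else 1) := by
    intro i
    rcases Nat.eq_zero_or_pos i with rfl | hi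
    · simp [partWeight, show 0 < j by omega]
    · simp only [partWeight, show i + 1 ≠ 1 by omega, if_false, show i ≠ 0 by omega]
      by_cases hij : i < j
      · simp only [hij, if_true, show ¬ j < i + 1 by omega, if_false]
        rw [one_add_tsum_pow_mul]
      · simp only [hij, if_true, show j < i + 1 by omega, if_false, mul_one]
        rw [one_add_tsum_pow_mul]
  rw [funext heq] at h1
  have := h1.unique h2
  have hr := finPoch_mul_recipPoch (R := R) j
  rw [← infPoch] at this
  linear_combination recipPoch R j * this
    - Nat.Partition.genFun (partWeight (fun _ ↦ 0) z j) * infPoch z * hr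

lemma genFun_partWeight_single (z : R) {j : ℕ} (hj : 1 ≤ j) :
    Nat.Partition.genFun (partWeight (fun m ↦ if m = j then 1 else 0) z j)
      = (1 + X ^ j) * Nat.Partition.genFun (partWeight (fun _ ↦ 0) z j) := by
  have h1 := Nat.Partition.hasProd_genFun (partWeight (fun m ↦ if m = j then (1 : R) else 0) z j)
  have h2 := Nat.Partition.hasProd_genFun (partWeight (fun _ ↦ (0 : R)) z j)
  have h0 : HasProd (fun i : ℕ ↦ if i = 0 then 1 + (X : R⟦X⟧) ^ j else 1) (1 + X ^ j) := by
    simpa using hasProd_ite_eq 0 (1 + (X : R⟦X⟧) ^ j)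
  refine h1.unique ?_
  refine (congrArg (HasProd · _) ?_).mp (h0.mul h2)
  funext i
  rcases Nat.eq_zero_or_pos i with rfl | hi
  · simp only [partWeight, zero_add, if_true]
    obtain ⟨k, rfl⟩ := Nat.exists_eq_add_of_le' hj
    rw [tsum_eq_single k fun _ _ ↦ by simp]
    simp
  · simp only [partWeight, show i + 1 ≠ 1 by omega, if_false, show i ≠ 0 by omega, one_mul]

end CrankSeries

section CrankSeries
variable {R : Type*} [CommRing R]

lemma sup_le_iff_forall {n : ℕ} (π : n.Partition) (m : ℕ) :
    π.parts.sup ≤ m ↔ (π.parts.filter (m < ·)).card = 0 := by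
  rw [Multiset.sup_le, Multiset.card_eq_zero, Multiset.filter_eq_nil]
  simp only [not_lt]

lemma sup_parts_le {n : ℕ} (π : n.Partition) : π.parts.sup ≤ n := by
  rw [Multiset.sup_le]
  exact fun b hb ↦ Multiset.single_le_sum (fun _ _ ↦ Nat.zero_le _) _ hb |>.trans_eq π.parts_sum

lemma count_one_le {n : ℕ} (π : n.Partition) : π.parts.count 1 ≤ n := by
  refine (Multiset.count_le_card _ _).trans ?_
  have := Multiset.card_nsmul_le_sum (s := π.parts) (a := 1) fun i hi ↦ π.parts_pos hi
  rwa [smul_eq_mul, mul_one, π.parts_sum] at this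

/-- The generating function of the partitions without ones whose largest part is `m`. -/
noncomputable def largestSeries (R : Type*) [CommRing R] (m : ℕ) : R⟦X⟧ :=
  PowerSeries.mk fun n ↦ ∑ π : n.Partition,
    if π.parts.count 1 = 0 ∧ π.parts.sup = m then 1 else 0

/-- The generating function of the partitions with exactly `j` ones, weighted by
`z` to the number of parts larger than `j`. -/
noncomputable def onesSeries (z : R) (j : ℕ) : R⟦X⟧ :=
  PowerSeries.mk fun n ↦ ∑ π : n.Partition,
    if π.parts.count 1 = j then z ^ (π.parts.filter (j < ·)).card else 0

/-- The generating function of the crank, with the exceptional value at `n = 1`. -/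
noncomputable def crankSeries (z : Rˣ) : R⟦X⟧ :=
  PowerSeries.mk (fun n ↦ ∑ π : n.Partition, ((z ^ partitionCrank π : Rˣ) : R))
    + C ((z : R) - 1) * X

lemma sup_parts_eq_zero {n : ℕ} {π : n.Partition} (h : π.parts.sup = 0) : n = 0 := by
  have h0 : ∀ b ∈ π.parts, b = 0 := fun b hb ↦ by
    have := Multiset.le_sup hb
    omega
  rw [← π.parts_sum]
  exact Multiset.sum_eq_zero h0

lemma crankSeries_eq_add (z : Rˣ) : crankSeries z
    = (PowerSeries.mk fun n ↦ ∑ π : n.Partition,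
        if π.parts.count 1 = 0 then (z : R) ^ π.parts.sup else 0)
      + (PowerSeries.mk fun n ↦ ∑ π : n.Partition, if 1 ≤ π.parts.count 1 then
          ((z⁻¹ : Rˣ) : R) ^ (π.parts.count 1)
            * (z : R) ^ (π.parts.filter (π.parts.count 1 < ·)).card else 0)
      + C ((z : R) - 1) * X := by
  rw [crankSeries]
  congr 1
  ext n
  rw [map_add, coeff_mk, coeff_mk, coeff_mk, ← sum_add_distrib]
  refine sum_congr rfl fun π _ ↦ ?_
  rw [partitionCrank]
  split_ifs with h1 h2 h2
  · omega
  · simp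
  · rw [zpow_sub]
    simp [mul_comm]
  · omega

lemma largestSeries_zero : largestSeries R 0 = 1 := by
  ext n
  rw [largestSeries, coeff_mk, coeff_one]
  split_ifs with h
  · subst h
    simp
  · refine sum_eq_zero fun π _ ↦ if_neg fun h' ↦ h (sup_parts_eq_zero h'.2)

lemma largestSeries_one : largestSeries R 1 = 0 := by
  ext n
  rw [largestSeries, coeff_mk, map_zero]
  refine sum_eq_zero fun π _ ↦ if_neg fun ⟨h1, h2⟩ ↦ ?_
  have h0 : π.parts.sup ≤ 0 := Multiset.sup_le.mpr fun b hb ↦ by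
    have := Multiset.le_sup hb
    have := π.parts_pos hb
    have : b ≠ 1 := fun hb1 ↦ Multiset.count_eq_zero.mp h1 (hb1 ▸ hb)
    omega
  omega

variable [TopologicalSpace R] [T2Space R] [IsTopologicalRing R]

omit [T2Space R] [IsTopologicalRing R] in
lemma infPoch_zero : infPoch (0 : R) = 1 := by simp [infPoch]

lemma largestSeries_succ {m : ℕ} (hm : 1 ≤ m) :
    largestSeries R (m + 1) = (1 - X) * recipPoch R (m + 1 : ℕ) * X ^ (m + 1) := by
  have key : largestSeries R (m + 1)
      = Nat.Partition.genFun (partWeight (fun _ ↦ (0 : R)) 0 (m + 1))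
        - Nat.Partition.genFun (partWeight (fun _ ↦ (0 : R)) 0 m) := by
    ext n
    rw [map_sub, coeff_genFun_partWeight _ _ (by omega), coeff_genFun_partWeight _ _ hm,
      ← sum_sub_distrib, largestSeries, coeff_mk]
    refine sum_congr rfl fun π _ ↦ ?_
    rw [zero_pow_eq, zero_pow_eq]
    simp only [← sup_le_iff_forall]
    by_cases h0 : π.parts.count 1 = 0
    · simp only [h0, true_and, if_true, one_mul]
      split_ifs <;> first | omega | simp
    · simp [h0]
  have h1 := genFun_partWeight_zero (0 : R) hm
  have h2 := genFun_partWeight_zero (0 : R) (show 1 ≤ m + 1 by omega)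
  have hf : ∀ j, finPoch (0 : R) j = 1 := fun j ↦ by simp [finPoch]
  rw [infPoch_zero, hf] at h1 h2
  have h3 := one_sub_mul_recipPoch (R := R) (m + 1)
  push_cast at h3
  rw [add_sub_cancel_right] at h3
  push_cast at h2 ⊢
  rw [key]
  linear_combination h2 - h1 + (1 - X) * h3

lemma onesSeries_mul_infPoch (z : R) {j : ℕ} (hj : 1 ≤ j) :
    onesSeries z j * infPoch z = (1 - X) * recipPoch R j * finPoch z j * X ^ j := by
  have key : onesSeries z j = X ^ j * Nat.Partition.genFun (partWeight (fun _ ↦ (0 : R)) z j) := by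
    have : onesSeries z j = Nat.Partition.genFun (partWeight (fun m ↦ if m = j then 1 else 0) z j)
        - Nat.Partition.genFun (partWeight (fun _ ↦ (0 : R)) z j) := by
      ext n
      rw [map_sub, coeff_genFun_partWeight _ _ hj, coeff_genFun_partWeight _ _ hj,
        ← sum_sub_distrib, onesSeries, coeff_mk]
      refine sum_congr rfl fun π _ ↦ ?_
      split_ifs <;> first | omega | simp
    rw [this, genFun_partWeight_single z hj]
    ring
  rw [key, mul_assoc, genFun_partWeight_zero z hj]
  ring

omit [T2Space R] [IsTopologicalRing R] in
lemma hasSum_C_mul_mk_fiber {f : ∀ n, Nat.Partition n → ℕ} (hf : ∀ n π, f n π ≤ n) (c : ℕ → R)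
    (w : ∀ n, Nat.Partition n → R) (k : ℕ) :
    HasSum (fun m ↦ C (c m) * PowerSeries.mk fun n ↦ ∑ π, if f n π = m + k then w n π else 0)
      (PowerSeries.mk fun n ↦ ∑ π, if k ≤ f n π then c (f n π - k) * w n π else 0) := by
  rw [hasSum_iff_hasSum_coeff]
  intro d
  simp only [coeff_C_mul, coeff_mk]
  have h := hasSum_sum_of_ne_finset_zero (L := .unconditional ℕ) (s := range (d + 1))
    (f := fun m ↦ c m * ∑ π, if f d π = m + k then w d π else 0) fun m hm ↦ by
      rw [sum_eq_zero, mul_zero]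
      intro π _
      have := hf d π
      rw [mem_range] at hm
      exact if_neg (by omega)
  refine (congrArg (HasSum _) ?_).mp h
  simp only [mul_sum]
  rw [sum_comm]
  refine sum_congr rfl fun π _ ↦ ?_
  have := hf d π
  split_ifs with hk
  · rw [sum_eq_single (f d π - k)]
    · rw [if_pos (by omega)]
    · intro m _ hm
      rw [if_neg (by omega), mul_zero]
    · intro hm
      rw [mem_range] at hm
      omega
  · exact sum_eq_zero fun m _ ↦ by rw [if_neg (by omega), mul_zero]

/-- The Andrews–Garvan generating function of the crank. -/
theorem crankSeries_mul (z : Rˣ) :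
    crankSeries z * infPoch (z : R) * infPoch ((z⁻¹ : Rˣ) : R) = infPoch 1 := by
  obtain ⟨e, he, he'⟩ := exists_hasSum_qBinomTerm (0 : R) z
  obtain ⟨b, hb, hb'⟩ := exists_hasSum_qBinomTerm (z : R) ((z⁻¹ : Rˣ) : R)
  rw [zero_mul, map_zero, zero_mul, sub_zero, one_mul, infPoch_zero] at he'
  rw [Units.mul_inv, map_one, one_mul] at hb'
  set G := PowerSeries.mk fun n ↦ ∑ π : n.Partition,
    if π.parts.count 1 = 0 then (z : R) ^ π.parts.sup else 0 with hG
  set H := PowerSeries.mk fun n ↦ ∑ π : n.Partition, if 1 ≤ π.parts.count 1 then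
    ((z⁻¹ : Rˣ) : R) ^ (π.parts.count 1)
      * (z : R) ^ (π.parts.filter (π.parts.count 1 < ·)).card else 0 with hH
  have r1 : (1 - X) * recipPoch R 1 = 1 := by
    have := one_sub_mul_recipPoch (R := R) 1
    simpa [recipPoch_zero] using this
  have hf : ∀ j, finPoch (0 : R) j = 1 := fun j ↦ by simp [finPoch]
  have hGe : G = (1 - X) * e + X - C (z : R) * X := by
    have h1 := hasSum_C_mul_mk_fiber (f := fun n π ↦ π.parts.sup) (fun n π ↦ sup_parts_le π)
      (fun m ↦ (z : R) ^ m) (fun n π ↦ if π.parts.count 1 = 0 then 1 else 0) 0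
    have e1 : (PowerSeries.mk fun n ↦ ∑ π : n.Partition, if 0 ≤ π.parts.sup then
        (z : R) ^ (π.parts.sup - 0) * (if π.parts.count 1 = 0 then 1 else 0) else 0) = G := by
      simp [hG]
    rw [e1] at h1
    have h2 := (hasSum_nat_add_iff' 2).mpr h1
    have h3 := ((hasSum_nat_add_iff' 2).mpr he).mul_left (1 - X)
    have e2 : ∀ m, (PowerSeries.mk fun n ↦ ∑ π : n.Partition,
        if π.parts.sup = m + 0 then (if π.parts.count 1 = 0 then (1 : R) else 0) else 0)
        = largestSeries R m := fun m ↦ by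
      simp only [largestSeries, add_zero, ← ite_and, and_comm]
    simp only [e2] at h2
    have e3 : ∀ m : ℕ, C ((z : R) ^ (m + 2)) * largestSeries R (m + 2)
        = (1 - X) * qBinomTerm (0 : R) z 1 (m + 2) := fun m ↦ by
      rw [largestSeries_succ (by omega), qBinomTerm, hf, map_pow]
      ring
    simp only [e3] at h2
    have := h2.unique h3
    simp only [sum_range_succ, sum_range_zero, largestSeries_zero, largestSeries_one,
      qBinomTerm_zero] at this
    simp only [qBinomTerm, hf] at this
    push_cast at this
    simp only [pow_zero, map_one, pow_one, one_mul, zero_add, mul_one, mul_zero, add_zero] at this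
    linear_combination this - C (z : R) * X * r1
  have hHe : H * infPoch (z : R) = (1 - X) * (b - 1) := by
    have h1 := hasSum_C_mul_mk_fiber (f := fun n π ↦ π.parts.count 1) (fun n π ↦ count_one_le π)
      (fun m ↦ ((z⁻¹ : Rˣ) : R) ^ (m + 1))
      (fun n π ↦ (z : R) ^ (π.parts.filter (π.parts.count 1 < ·)).card) 1
    have e1 : (PowerSeries.mk fun n ↦ ∑ π : n.Partition, if 1 ≤ π.parts.count 1 then
        ((z⁻¹ : Rˣ) : R) ^ (π.parts.count 1 - 1 + 1)
          * (z : R) ^ (π.parts.filter (π.parts.count 1 < ·)).card else 0) = H := by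
      rw [hH]
      congr 1
      funext n
      refine sum_congr rfl fun π _ ↦ ?_
      split_ifs with h
      · rw [Nat.sub_add_cancel h]
      · rfl
    rw [e1] at h1
    have h2 := h1.mul_right (infPoch (z : R))
    have h3 := ((hasSum_nat_add_iff' 1).mpr hb).mul_left (1 - X)
    have e2 : ∀ m, (PowerSeries.mk fun n ↦ ∑ π : n.Partition, if π.parts.count 1 = m + 1 then
          (z : R) ^ (π.parts.filter (π.parts.count 1 < ·)).card else 0)
        = onesSeries (z : R) (m + 1) := fun m ↦ by
      rw [onesSeries]
      congr 1
      funext n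
      refine sum_congr rfl fun π _ ↦ ?_
      split_ifs with h
      · rw [h]
      · rfl
    have e3 : ∀ m : ℕ, C (((z⁻¹ : Rˣ) : R) ^ (m + 1)) * onesSeries (z : R) (m + 1) * infPoch (z : R)
        = (1 - X) * qBinomTerm (z : R) ((z⁻¹ : Rˣ) : R) 1 (m + 1) := fun m ↦ by
      rw [mul_assoc, onesSeries_mul_infPoch _ (by omega), qBinomTerm, map_pow]
      ring
    simp only [e2, e3] at h2
    have := h2.unique h3
    simpa [qBinomTerm_zero] using this
  rw [crankSeries_eq_add, ← hG, ← hH, hGe, map_sub, map_one]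
  linear_combination hb' + infPoch ((z⁻¹ : Rˣ) : R) * hHe
    + (1 - X) * infPoch ((z⁻¹ : Rˣ) : R) * he'

end CrankSeries

local notation "χ" => (ZMod.stdAddChar : AddChar (ZMod 11) ℂ)

section RootsOfUnity

/-- The value at a primitive eleventh root of unity of an element of the group ring of `ZMod 11`. -/
noncomputable def evalRoot (f : ZMod 11 → ℤ) : ℂ := ∑ k, (f k : ℂ) * χ k

/-- The multiplication of the group ring of `ZMod 11`. -/
def conv (f g : ZMod 11 → ℤ) (k : ZMod 11) : ℤ := ∑ j, f j * g (k - j)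

/-- The element of the group ring with coefficient `1` at `e`. -/
def basisElt (e k : ZMod 11) : ℤ := if k = e then 1 else 0

lemma evalRoot_basisElt (e : ZMod 11) : evalRoot (basisElt e) = χ e := by
  simp [evalRoot, basisElt]

lemma evalRoot_conv (f g : ZMod 11 → ℤ) : evalRoot (conv f g) = evalRoot f * evalRoot g := by
  simp only [evalRoot, conv, sum_mul_sum]
  push_cast
  simp only [sum_mul]
  rw [sum_comm]
  refine sum_congr rfl fun j _ ↦ ?_
  refine Fintype.sum_equiv (Equiv.subRight j) _ _ fun k ↦ ?_
  rw [Equiv.subRight_apply, show χ k = χ j * χ (k - j) by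
    rw [← AddChar.map_add_eq_mul, add_sub_cancel]]
  ring

lemma evalRoot_add (f g : ZMod 11 → ℤ) : evalRoot (f + g) = evalRoot f + evalRoot g := by
  simp [evalRoot, add_mul, sum_add_distrib]

lemma evalRoot_sub (f g : ZMod 11 → ℤ) : evalRoot (f - g) = evalRoot f - evalRoot g := by
  simp [evalRoot, sub_mul, sum_sub_distrib]

lemma evalRoot_zsmul (c : ℤ) (f : ZMod 11 → ℤ) : evalRoot (c • f) = c * evalRoot f := by
  simp [evalRoot, mul_sum, mul_assoc]

lemma stdAddChar_eq_pow (k : ZMod 11) : χ k = χ 1 ^ k.val := by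
  rw [← AddChar.map_nsmul_eq_pow]
  simp

lemma isPrimitiveRoot_stdAddChar_one : IsPrimitiveRoot (χ 1) 11 := by
  have h := Complex.isPrimitiveRoot_exp 11 (by norm_num)
  have e := ZMod.stdAddChar_coe (N := 11) 1
  push_cast at e
  rw [e]
  simpa using h

/-- The eleventh roots of unity satisfy no integral linear relation other than the vanishing of
the multiples of their sum. -/
lemma eq_of_evalRoot_eq_zero {f : ZMod 11 → ℤ} (h : evalRoot f = 0) (k : ZMod 11) :
    f k = f 10 := by
  have hp := isPrimitiveRoot_stdAddChar_one
  have hmin := Polynomial.cyclotomic_eq_minpoly_rat hp (by norm_num)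
  have hsum : ∑ k : ZMod 11, χ k = 0 := by
    rw [AddChar.sum_eq_zero_iff_ne_zero]
    intro h0
    have := hp.ne_one (by norm_num)
    rw [h0] at this
    simp at this
  let Q : Polynomial ℚ := ∑ k : ZMod 11, Polynomial.C ((f k : ℚ) - f 10) * Polynomial.X ^ k.val
  have hQ : Polynomial.aeval (χ 1) Q = 0 := by
    simp only [Q, map_sum, map_mul, map_pow, Polynomial.aeval_X, Polynomial.aeval_C,
      ← stdAddChar_eq_pow]
    simp only [map_sub, map_intCast, sub_mul, sum_sub_distrib]
    rw [← mul_sum, hsum, mul_zero, sub_zero]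
    exact h
  have hcoeff : ∀ k : ZMod 11, Q.coeff k.val = (f k : ℚ) - f 10 := fun k ↦ by
    simp only [Q, Polynomial.finsetSum_coeff, Polynomial.coeff_C_mul_X_pow]
    rw [sum_eq_single k]
    · simp
    · intro j _ hj
      rw [if_neg fun h ↦ hj (ZMod.val_injective 11 h).symm]
    · simp
  have hdeg : Q.degree < (10 : ℕ) := by
    refine (Polynomial.degree_lt_iff_coeff_zero _ _).mpr fun m hm ↦ ?_
    simp only [Q, Polynomial.finsetSum_coeff, Polynomial.coeff_C_mul_X_pow]
    refine sum_eq_zero fun j _ ↦ ?_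
    split_ifs with hj
    · have hj' : j = 10 := ZMod.val_injective 11 (by
        have := ZMod.val_lt j
        have e : (10 : ZMod 11).val = 10 := rfl
        omega)
      rw [hj', sub_self]
    · rfl
  have hQ0 : Q = 0 := by
    by_contra hne
    have h1 := minpoly.degree_le_of_ne_zero ℚ (χ 1) hne hQ
    rw [← hmin, Polynomial.degree_cyclotomic] at h1
    have h2 : Nat.totient 11 = 10 := by decide
    rw [h2] at h1
    exact absurd (lt_of_le_of_lt h1 hdeg) (lt_irrefl _)
  have := hcoeff k
  rw [hQ0, Polynomial.coeff_zero] at this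
  exact_mod_cast (sub_eq_zero.mp this.symm)

/-- The group ring element whose value is `(1 - ζ ^ 5) (1 - ζ ^ 2) (1 - ζ ^ 7) (1 - ζ ^ 3)`. -/
def prefactor : ZMod 11 → ℤ :=
  conv (conv (basisElt 0 - basisElt 5) (basisElt 0 - basisElt 2))
    (conv (basisElt 0 - basisElt 7) (basisElt 0 - basisElt 3))

/-- The group ring element describing the cranks of the integers congruent to `r`. -/
def profile (r : ZMod 11) : ZMod 11 → ℤ :=
  let s (j : ZMod 11) : ZMod 11 → ℤ := basisElt j + basisElt (-j)
  let one : ZMod 11 → ℤ := basisElt 0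
  if r = 0 then one
  else if r = 1 then s 1 - one
  else if r = 2 then s 2
  else if r = 3 then one + s 3
  else if r = 4 then one + s 2 + s 4
  else if r = 5 then s 2 + s 4
  else if r = 6 then 0
  else if r = 7 then s 1 + s 4
  else if r = 8 then one + s 2 + s 5
  else if r = 9 then one + s 4
  else s 3

/-- The group ring form of `winquistCoeff` at `a = ζ ^ 5` and `b = ζ ^ 2`, up to sign. -/
def rootCoeff (x y : ZMod 11) : ZMod 11 → ℤ :=
  conv (basisElt (5 * (-3 * y)) - basisElt (5 * (3 * y + 3)))
      (basisElt (2 * (3 * x)) - basisElt (2 * (1 - 3 * x)))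
    - conv (basisElt (5 * (2 - 3 * x)) - basisElt (5 * (3 * x + 1)))
      (basisElt (2 * (3 * y + 2)) - basisElt (2 * (-3 * y - 1)))

lemma rootCoeff_eq (x y : ZMod 11) :
    ∃ s ∈ ({0, 1, -1} : Finset ℤ), ∀ k, rootCoeff x y k
      = s * conv prefactor
        (profile (2 * (3 * x * (3 * x - 1) + (3 * y + 2) * (3 * y + 1)) - 4)) k := by
  revert x y
  decide +kernel

end RootsOfUnity

section Specialization

lemma prod_one_sub_C_mul (Y : ℂ⟦X⟧) : ∏ k : ZMod 11, (1 - C (χ k) * Y) = 1 - Y ^ 11 := by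
  classical
  have hinj : Function.Injective (C : ℂ →+* ℂ⟦X⟧) := C_injective
  have hp := isPrimitiveRoot_stdAddChar_one.map_of_injective hinj
  have hinj' : Function.Injective fun k : ZMod 11 ↦ (C (χ k) : ℂ⟦X⟧) :=
    hinj.comp ZMod.injective_stdAddChar
  have himg : univ.image (fun k : ZMod 11 ↦ (C (χ k) : ℂ⟦X⟧))
      = Polynomial.nthRootsFinset 11 (1 : ℂ⟦X⟧) := by
    refine eq_of_subset_of_card_le (fun x hx ↦ ?_) ?_
    · obtain ⟨k, -, rfl⟩ := mem_image.mp hx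
      rw [Polynomial.mem_nthRootsFinset (by norm_num), ← map_pow, ← AddChar.map_nsmul_eq_pow]
      have : 11 • k = 0 := by
        rw [nsmul_eq_mul]
        exact (congrArg (· * k) (ZMod.natCast_self 11)).trans (zero_mul k)
      rw [this, AddChar.map_zero_eq_one, map_one]
    · rw [hp.card_nthRootsFinset, card_image_of_injective _ hinj', card_univ, ZMod.card]
  have := hp.pow_sub_pow_eq_prod_sub_mul 1 Y (by norm_num)
  rw [one_pow] at this
  rw [this, ← himg, prod_image fun _ _ _ _ h ↦ hinj' h]

lemma prod_infPoch : ∏ k : ZMod 11, infPoch (χ k)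
    = expand 11 (by norm_num) (infPoch (1 : ℂ)) := by
  have hfin : ∀ n, ∏ k : ZMod 11, finPoch (χ k) n = expand 11 (by norm_num) (finPoch (1 : ℂ) n) :=
    fun n ↦ by
    simp only [finPoch]
    rw [Finset.prod_comm, map_prod]
    refine prod_congr rfl fun i _ ↦ ?_
    rw [prod_one_sub_C_mul]
    simp only [map_one, one_mul, map_sub, map_pow, expand_X]
    ring
  refine tendsto_nhds_unique (tendsto_finsetProd univ fun k _ ↦ tendsto_finPoch (χ k)) ?_
  simp only [hfin]
  refine (tendsto_iff_coeff_tendsto ℂ _ _ _).mpr fun d ↦ ?_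
  refine tendsto_atTop_of_eventually_const (i₀ := d) fun n hn ↦ ?_
  rw [coeff_expand, coeff_expand]
  split_ifs
  · rw [coeff_infPoch _ ((Nat.div_le_self d 11).trans hn)]
  · rfl

lemma map_infPoch_one : map (Int.castRingHom ℂ) (infPoch (1 : ℤ)) = infPoch 1 := by
  ext d
  rw [coeff_map, coeff_infPoch _ le_rfl, coeff_infPoch _ le_rfl, ← coeff_map]
  simp [finPoch, map_prod]

/-- The reciprocal of the product of the `infPoch (ζ ^ k)` is an integral series in `q ^ 11`. -/
lemma exists_mul_prod_infPoch_eq_one :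
    ∃ g : ℤ⟦X⟧, expand 11 (by norm_num) (map (Int.castRingHom ℂ) g) * ∏ k : ZMod 11, infPoch (χ k)
      = 1 := by
  refine ⟨invOfUnit (infPoch 1) 1, ?_⟩
  rw [prod_infPoch, ← map_infPoch_one, ← map_mul, ← map_mul, mul_comm, mul_invOfUnit,
    map_one, map_one]
  simp [constantCoeff_infPoch]

/-- The power `ζ ^ k` as a unit. -/
noncomputable def rootUnit (k : ZMod 11) : ℂˣ := ⟨χ k, χ (-k),
  by rw [← AddChar.map_add_eq_mul, add_neg_cancel, AddChar.map_zero_eq_one],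
  by rw [← AddChar.map_add_eq_mul, neg_add_cancel, AddChar.map_zero_eq_one]⟩

lemma val_rootUnit (k : ZMod 11) : (rootUnit k : ℂ) = χ k := rfl

lemma rootUnit_mul (j k : ZMod 11) : rootUnit j * rootUnit k = rootUnit (j + k) :=
  Units.ext (AddChar.map_add_eq_mul _ _ _).symm

lemma rootUnit_inv (k : ZMod 11) : (rootUnit k)⁻¹ = rootUnit (-k) := Units.ext rfl

lemma rootUnit_zpow (k : ZMod 11) (m : ℤ) : rootUnit k ^ m = rootUnit (k * m) := by
  refine Units.ext ?_
  rw [Units.val_zpow_eq_zpow_val, val_rootUnit, val_rootUnit, ← AddChar.map_zsmul_eq_zpow,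
    zsmul_eq_mul, mul_comm]

lemma neg_rootUnit_zpow (k : ZMod 11) (m : ℤ) :
    (((-rootUnit k) ^ m : ℂˣ) : ℂ) = (-1) ^ m * χ (k * m) := by
  rw [neg_eq_neg_one_mul, mul_zpow, rootUnit_zpow, Units.val_mul, Units.val_zpow_eq_zpow_val,
    val_rootUnit]
  simp

lemma winquistCoeff_rootUnit (x y : ℤ) :
    winquistCoeff (rootUnit 5) (rootUnit 2) x y = (-1) ^ (x + y) * evalRoot (rootCoeff x y) := by
  have hone : (-1 : ℂ) ≠ 0 := by norm_num
  have h3 : ∀ t : ℤ, (-1 : ℂ) ^ (3 * t) = (-1) ^ t := fun t ↦ by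
    rw [zpow_mul]; norm_num
  have hn : ∀ t : ℤ, (-1 : ℂ) ^ (-t) = (-1) ^ t := fun t ↦ by
    rw [zpow_neg, ← inv_zpow]; norm_num
  have e1 : (-1 : ℂ) ^ (3 * y + 3) = -(-1) ^ y := by
    rw [zpow_add₀ hone, h3]; norm_num
  have e2 : (-1 : ℂ) ^ (-3 * y) = (-1) ^ y := by rw [neg_mul, hn, h3]
  have e3 : (-1 : ℂ) ^ (1 - 3 * x) = -(-1) ^ x := by
    rw [sub_eq_add_neg, zpow_add₀ hone, hn, h3]; norm_num
  have e4 : (-1 : ℂ) ^ (3 * x + 1) = -(-1) ^ x := by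
    rw [zpow_add₀ hone, h3]; norm_num
  have e5 : (-1 : ℂ) ^ (2 - 3 * x) = (-1) ^ x := by
    rw [sub_eq_add_neg, zpow_add₀ hone, hn, h3]; norm_num
  have e6 : (-1 : ℂ) ^ (3 * y + 2) = (-1) ^ y := by
    rw [zpow_add₀ hone, h3]; norm_num
  have e7 : (-1 : ℂ) ^ (-3 * y - 1) = -(-1) ^ y := by
    rw [sub_eq_add_neg, zpow_add₀ hone, neg_mul, hn, hn, h3]; norm_num
  simp only [winquistCoeff, neg_rootUnit_zpow, e1, e2, e3, e4, e5, e6, e7, h3, rootCoeff,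
    evalRoot_sub, evalRoot_conv, evalRoot_basisElt]
  rw [zpow_add₀ hone]
  push_cast
  ring

lemma evalRoot_prefactor :
    evalRoot prefactor = (1 - χ 5) * (1 - χ 2) * ((1 - χ 7) * (1 - χ 3)) := by
  simp only [prefactor, evalRoot_conv, evalRoot_sub, evalRoot_basisElt, AddChar.map_zero_eq_one]

lemma evalRoot_prefactor_ne_zero : evalRoot prefactor ≠ 0 := by
  have h : ∀ k : ZMod 11, k ≠ 0 → 1 - χ k ≠ 0 := fun k hk h0 ↦ hk <|
    ZMod.injective_stdAddChar (by rw [AddChar.map_zero_eq_one, sub_eq_zero.mp h0])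
  rw [evalRoot_prefactor]
  have h5 := h 5 (by decide)
  have h2 := h 2 (by decide)
  have h7 := h 7 (by decide)
  have h3 := h 3 (by decide)
  positivity

/-- The product in Winquist's identity at `a = ζ ^ 5` and `b = ζ ^ 2`. -/
noncomputable def rootProd : ℂ⟦X⟧ :=
  thetaProd (rootUnit 5) * thetaProd (rootUnit 2) * thetaProd (rootUnit 5 * rootUnit 2)
    * thetaProd (rootUnit 5 * (rootUnit 2)⁻¹) * infPoch 1 ^ 2

lemma rootProd_eq :
    rootProd = C (evalRoot prefactor) * crankSeries (rootUnit 1) * ∏ k : ZMod 11, infPoch (χ k) := by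
  have hc := crankSeries_mul (rootUnit 1)
  rw [rootUnit_inv, val_rootUnit, val_rootUnit] at hc
  have hprod (F : Fin 11 → ℂ⟦X⟧) : ∏ k, F k
      = F 0 * F 1 * F 2 * F 3 * F 4 * F 5 * F 6 * F 7 * F 8 * F 9 * F 10 := by
    simp only [Fin.prod_univ_castSucc, univ_eq_empty, prod_empty, one_mul]
    rfl
  have hprod' := hprod fun k ↦ infPoch ((ZMod.stdAddChar : AddChar (ZMod 11) ℂ) k)
  change ∏ k : ZMod 11, infPoch (χ k) = infPoch (χ 0) * infPoch (χ 1) * infPoch (χ 2)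
      * infPoch (χ 3) * infPoch (χ 4) * infPoch (χ 5) * infPoch (χ 6) * infPoch (χ 7)
      * infPoch (χ 8) * infPoch (χ 9) * infPoch (χ 10) at hprod'
  rw [hprod', evalRoot_prefactor, AddChar.map_zero_eq_one]
  simp only [rootProd, thetaProd, rootUnit_inv, rootUnit_mul, val_rootUnit, map_mul, map_sub,
    map_one]
  rw [show (-1 : ZMod 11) = 10 from rfl] at hc
  rw [show (5 + 2 : ZMod 11) = 7 from rfl, show (5 + -2 : ZMod 11) = 3 from rfl,
    show (-5 : ZMod 11) = 6 from rfl, show (-2 : ZMod 11) = 9 from rfl,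
    show (-7 : ZMod 11) = 4 from rfl, show (-3 : ZMod 11) = 8 from rfl]
  linear_combination (-(1 - C (χ 5)) * (1 - C (χ 2)) * (1 - C (χ 7)) * (1 - C (χ 3)) * infPoch 1
    * infPoch (χ 2) * infPoch (χ 3) * infPoch (χ 4) * infPoch (χ 5) * infPoch (χ 6)
    * infPoch (χ 7) * infPoch (χ 8) * infPoch (χ 9)) * hc

end Specialization

section CrankCounts

lemma exists_two_mul_coeff_rootProd (n : ℕ) :
    ∃ t : ℤ, 2 * coeff n rootProd = t * (evalRoot prefactor * evalRoot (profile n)) := by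
  have h := isMonoSum_winquist (rootUnit 5) (rootUnit 2)
  rw [← map_ofNat (C : ℂ →+* ℂ⟦X⟧) 2] at h
  have hc := h.coeff_eq_sum (3 * n + 1)
  change coeff (3 * n + 1) (C 2 * (X * expand 3 three_ne_zero rootProd)) = _ at hc
  rw [coeff_C_mul, coeff_succ_X_mul, coeff_expand_mul] at hc
  have hmem : ∀ p ∈ (h.finite (3 * n + 1)).toFinset,
      winquistCoeff (rootUnit 5) (rootUnit 2) p.1 p.2
        ∈ AddSubgroup.zmultiples (evalRoot prefactor * evalRoot (profile n)) := by
    rintro ⟨x, y⟩ hp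
    rw [Set.Finite.mem_toFinset, Set.mem_ofPred_eq] at hp
    dsimp only at hp ⊢
    have hx := two_mul_tri (3 * x)
    have hy := two_mul_tri (3 * y + 2)
    have hz : 3 * x * (3 * x - 1) + (3 * y + 2) * (3 * y + 1) = 2 * (3 * (n : ℤ) + 1) := by
      have : (tri (3 * x) : ℤ) + tri (3 * y + 2) = 3 * n + 1 := by exact_mod_cast hp
      linear_combination 2 * this - hx - hy
    have hN : 2 * (3 * (x : ZMod 11) * (3 * x - 1) + (3 * y + 2) * (3 * y + 1)) - 4 = n := by
      have h11 : (11 : ZMod 11) = 0 := rfl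
      have := congrArg (Int.cast : ℤ → ZMod 11) hz
      push_cast at this
      linear_combination 2 * this + n * h11
    obtain ⟨s, -, hs⟩ := rootCoeff_eq x y
    rw [hN] at hs
    have hs' : rootCoeff x y = s • conv prefactor (profile n) := funext fun k ↦ by
      rw [hs k, Pi.smul_apply, smul_eq_mul]
    rw [winquistCoeff_rootUnit, hs', evalRoot_zsmul, evalRoot_conv, AddSubgroup.mem_zmultiples_iff]
    rcases Int.even_or_odd (x + y) with he | ho
    · exact ⟨s, by rw [he.neg_one_zpow, one_mul, zsmul_eq_mul]⟩
    · exact ⟨-s, by rw [ho.neg_one_zpow, zsmul_eq_mul]; push_cast; ring⟩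
  obtain ⟨t, ht⟩ := AddSubgroup.mem_zmultiples_iff.mp (sum_mem hmem)
  exact ⟨t, by rw [hc, ← ht, zsmul_eq_mul]⟩

lemma exists_two_mul_coeff_crankSeries (n : ℕ) :
    ∃ t : ℤ, 2 * coeff n (crankSeries (rootUnit 1)) = t * evalRoot (profile n) := by
  obtain ⟨g, hg⟩ := exists_mul_prod_infPoch_eq_one
  set v := expand 11 (by norm_num) (map (Int.castRingHom ℂ) g) with hv
  have hmul : C (evalRoot prefactor) * crankSeries (rootUnit 1) = v * rootProd := by
    rw [rootProd_eq]
    linear_combination (-C (evalRoot prefactor) * crankSeries (rootUnit 1)) * hg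
  have hmem : 2 * coeff n (v * rootProd)
      ∈ AddSubgroup.zmultiples (evalRoot prefactor * evalRoot (profile n)) := by
    rw [coeff_mul, mul_sum]
    refine sum_mem fun p hp ↦ ?_
    rw [HasAntidiagonal.mem_antidiagonal] at hp
    rw [hv, coeff_expand]
    split_ifs with hd
    · have hcast : (p.2 : ZMod 11) = n := by
        rw [← hp, Nat.cast_add, (ZMod.natCast_eq_zero_iff _ _).mpr hd, zero_add]
      obtain ⟨t, ht⟩ := exists_two_mul_coeff_rootProd p.2
      rw [hcast] at ht
      refine AddSubgroup.mem_zmultiples_iff.mpr ⟨coeff (p.1 / 11) g * t, ?_⟩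
      rw [coeff_map, eq_intCast, zsmul_eq_mul]
      push_cast
      linear_combination -((coeff (p.1 / 11) g : ℤ) : ℂ) * ht
    · rw [zero_mul, mul_zero]
      exact zero_mem _
  obtain ⟨t, ht⟩ := AddSubgroup.mem_zmultiples_iff.mp hmem
  rw [← hmul, coeff_C_mul, zsmul_eq_mul] at ht
  refine ⟨t, mul_left_cancel₀ evalRoot_prefactor_ne_zero ?_⟩
  linear_combination -ht

lemma emod_eleven_eq_iff (c : ℤ) (k : ZMod 11) : c % 11 = (k.val : ℤ) % 11 ↔ (c : ZMod 11) = k := by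
  have := ZMod.intCast_eq_intCast_iff' c k.val 11
  rw [Int.cast_natCast, ZMod.natCast_zmod_val] at this
  exact this.symm

lemma coeff_crankSeries_rootUnit (n : ℕ) :
    coeff n (crankSeries (rootUnit 1)) = evalRoot fun k ↦ crankCount k.val n := by
  have hroot : ∀ c : ℤ, ((rootUnit 1 ^ c : ℂˣ) : ℂ) = χ c := fun c ↦ by
    rw [rootUnit_zpow, one_mul, val_rootUnit]
  rw [crankSeries, map_add, coeff_mk, coeff_C_mul, coeff_X]
  simp only [hroot, val_rootUnit]
  by_cases hn : n = 1
  · subst hn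
    have h1 : ∀ π : Nat.Partition 1, partitionCrank π = -1 := fun π ↦ by
      simp [partitionCrank, Nat.Partition.partition_one_parts]
    have h2 : (fun k : ZMod 11 ↦ crankCount k.val 1)
        = basisElt (-1) - basisElt 0 + basisElt 1 := by
      funext k; revert k; decide
    simp only [h1, h2, evalRoot_add, evalRoot_sub, evalRoot_basisElt, sum_const, card_univ]
    rw [show Fintype.card (Nat.Partition 1) = 1 from rfl, AddChar.map_zero_eq_one]
    push_cast
    simp
    ring
  · rw [if_neg hn, mul_zero, add_zero, evalRoot]
    rw [← sum_fiberwise_of_maps_to (t := univ) (g := fun π ↦ (partitionCrank π : ZMod 11))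
      fun _ _ ↦ mem_univ _]
    refine sum_congr rfl fun k _ ↦ ?_
    simp only [crankCount, if_neg hn, emod_eleven_eq_iff]
    rw [sum_congr rfl fun π hπ ↦ by rw [(mem_filter.mp hπ).2], sum_const, nsmul_eq_mul]
    push_cast
    rfl

lemma exists_crankCount_eq (n : ℕ) :
    ∃ c t : ℤ, ∀ k : ZMod 11, 2 * crankCount k.val n = c + t * profile n k := by
  obtain ⟨t, ht⟩ := exists_two_mul_coeff_crankSeries n
  rw [coeff_crankSeries_rootUnit] at ht
  set M : ZMod 11 → ℤ := fun k ↦ crankCount k.val n with hM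
  have h0 : evalRoot ((2 : ℤ) • M - t • profile n) = 0 := by
    rw [evalRoot_sub, evalRoot_zsmul, evalRoot_zsmul, ← ht]
    push_cast
    ring
  refine ⟨((2 : ℤ) • M - t • profile n) 10, t, fun k ↦ ?_⟩
  have := eq_of_evalRoot_eq_zero h0 k
  rw [← this]
  simp [hM]

lemma sum_crankCount {n : ℕ} (hn : n ≠ 1) :
    ∑ k : ZMod 11, crankCount k.val n = partitionCount n := by
  simp only [crankCount, if_neg hn, emod_eleven_eq_iff]
  rw [partitionCount, ← card_univ, card_eq_sum_card_fiberwise (t := univ)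
    (f := fun π : Nat.Partition n ↦ (partitionCrank π : ZMod 11)) fun _ _ ↦ mem_coe.mpr (mem_univ _)]
  push_cast
  rfl

lemma exists_crankCount_progression (n r : ℕ) {u₀ u₁ u₂ u₃ u₄ u₅ : ℤ}
    (h : profile r 0 = u₀ ∧ profile r 1 = u₁ ∧ profile r 2 = u₂ ∧ profile r 3 = u₃
      ∧ profile r 4 = u₄ ∧ profile r 5 = u₅) :
    ∃ c t : ℤ, 2 * crankCount 0 (11 * n + r) = c + t * u₀
      ∧ 2 * crankCount 1 (11 * n + r) = c + t * u₁ ∧ 2 * crankCount 2 (11 * n + r) = c + t * u₂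
      ∧ 2 * crankCount 3 (11 * n + r) = c + t * u₃ ∧ 2 * crankCount 4 (11 * n + r) = c + t * u₄
      ∧ 2 * crankCount 5 (11 * n + r) = c + t * u₅ := by
  obtain ⟨c, t, hk⟩ := exists_crankCount_eq (11 * n + r)
  have hN : ((11 * n + r : ℕ) : ZMod 11) = r := by
    have h11 : (11 : ZMod 11) = 0 := rfl
    push_cast
    linear_combination n * h11
  rw [hN] at hk
  obtain ⟨rfl, rfl, rfl, rfl, rfl, rfl⟩ := h
  exact ⟨c, t, hk 0, hk 1, hk 2, hk 3, hk 4, hk 5⟩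

lemma eleven_mul_crankCount_zero (n : ℕ) :
    11 * crankCount 0 (11 * n + 6) = partitionCount (11 * n + 6) := by
  obtain ⟨c, t, hk⟩ := exists_crankCount_eq (11 * n + 6)
  have hN : ((11 * n + 6 : ℕ) : ZMod 11) = 6 := by
    have h11 : (11 : ZMod 11) = 0 := rfl
    push_cast
    linear_combination n * h11
  have hp : profile 6 = 0 := by decide
  rw [hN, hp] at hk
  have h0 : 2 * crankCount 0 (11 * n + 6) = _ := hk 0
  have hsum := sum_crankCount (n := 11 * n + 6) (by omega)
  have hconst : ∀ k ∈ (univ : Finset (ZMod 11)),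
      crankCount k.val (11 * n + 6) = crankCount 0 (11 * n + 6) := fun k _ ↦ by
    have := hk k
    simp only [Pi.zero_apply] at this h0
    linarith
  rw [sum_congr rfl hconst, sum_const, card_univ, ZMod.card, nsmul_eq_mul] at hsum
  exact_mod_cast hsum

end CrankCounts

end CrankModEleven

/-- Garvan's crank equalities modulo 11. -/
theorem crank_equalities_mod_eleven (n : ℕ) :
    (crankCount 1 (11  *  n) = crankCount 2 (11  *  n))
    ∧ (crankCount 2 (11  *  n) = crankCount 3 (11  *  n))
    ∧ (crankCount 3 (11  *  n) = crankCount 4 (11  *  n))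
    ∧ (crankCount 4 (11  *  n) = crankCount 5 (11  *  n))
    ∧ (crankCount 0 (11  *  n  +  1)  +  crankCount 1 (11  *  n  +  1) = 2 * crankCount 2 (11  *  n  +  1))
    ∧ (crankCount 2 (11  *  n  +  1) = crankCount 3 (11  *  n  +  1))
    ∧ (crankCount 3 (11  *  n  +  1) = crankCount 4 (11  *  n  +  1))
    ∧ (crankCount 4 (11  *  n  +  1) = crankCount 5 (11  *  n  +  1))
    ∧ (crankCount 0 (11  *  n  +  2) = crankCount 1 (11  *  n  +  2))
    ∧ (crankCount 1 (11  *  n  +  2) = crankCount 3 (11  *  n  +  2))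
    ∧ (crankCount 3 (11  *  n  +  2) = crankCount 4 (11  *  n  +  2))
    ∧ (crankCount 4 (11  *  n  +  2) = crankCount 5 (11  *  n  +  2))
    ∧ (crankCount 0 (11  *  n  +  3) = crankCount 3 (11  *  n  +  3))
    ∧ (crankCount 1 (11  *  n  +  3) = crankCount 2 (11  *  n  +  3))
    ∧ (crankCount 2 (11  *  n  +  3) = crankCount 4 (11  *  n  +  3))
    ∧ (crankCount 4 (11  *  n  +  3) = crankCount 5 (11  *  n  +  3))
    ∧ (crankCount 0 (11  *  n  +  4) = crankCount 2 (11  *  n  +  4))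
    ∧ (crankCount 2 (11  *  n  +  4) = crankCount 4 (11  *  n  +  4))
    ∧ (crankCount 1 (11  *  n  +  4) = crankCount 3 (11  *  n  +  4))
    ∧ (crankCount 3 (11  *  n  +  4) = crankCount 5 (11  *  n  +  4))
    ∧ (crankCount 0 (11  *  n  +  5) = crankCount 1 (11  *  n  +  5))
    ∧ (crankCount 1 (11  *  n  +  5) = crankCount 3 (11  *  n  +  5))
    ∧ (crankCount 3 (11  *  n  +  5) = crankCount 5 (11  *  n  +  5))
    ∧ (crankCount 2 (11  *  n  +  5) = crankCount 4 (11  *  n  +  5))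
    ∧ (crankCount 0 (11  *  n  +  6) = crankCount 1 (11  *  n  +  6))
    ∧ (crankCount 1 (11  *  n  +  6) = crankCount 2 (11  *  n  +  6))
    ∧ (crankCount 2 (11  *  n  +  6) = crankCount 3 (11  *  n  +  6))
    ∧ (crankCount 3 (11  *  n  +  6) = crankCount 4 (11  *  n  +  6))
    ∧ (crankCount 4 (11  *  n  +  6) = crankCount 5 (11  *  n  +  6))
    ∧ (11 * crankCount 0 (11 * n + 6) = (partitionCount (11 * n + 6) : ℤ))
    ∧ (crankCount 0 (11  *  n  +  7) = crankCount 2 (11  *  n  +  7))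
    ∧ (crankCount 2 (11  *  n  +  7) = crankCount 3 (11  *  n  +  7))
    ∧ (crankCount 3 (11  *  n  +  7) = crankCount 5 (11  *  n  +  7))
    ∧ (crankCount 1 (11  *  n  +  7) = crankCount 4 (11  *  n  +  7))
    ∧ (crankCount 0 (11  *  n  +  8) = crankCount 2 (11  *  n  +  8))
    ∧ (crankCount 2 (11  *  n  +  8) = crankCount 5 (11  *  n  +  8))
    ∧ (crankCount 1 (11  *  n  +  8) = crankCount 3 (11  *  n  +  8))
    ∧ (crankCount 3 (11  *  n  +  8) = crankCount 4 (11  *  n  +  8))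
    ∧ (crankCount 0 (11  *  n  +  9) = crankCount 4 (11  *  n  +  9))
    ∧ (crankCount 1 (11  *  n  +  9) = crankCount 2 (11  *  n  +  9))
    ∧ (crankCount 2 (11  *  n  +  9) = crankCount 3 (11  *  n  +  9))
    ∧ (crankCount 3 (11  *  n  +  9) = crankCount 5 (11  *  n  +  9))
    ∧ (crankCount 0 (11  *  n  +  10) = crankCount 1 (11  *  n  +  10))
    ∧ (crankCount 1 (11  *  n  +  10) = crankCount 2 (11  *  n  +  10))
    ∧ (crankCount 2 (11  *  n  +  10) = crankCount 4 (11  *  n  +  10))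
    ∧ (crankCount 4 (11  *  n  +  10) = crankCount 5 (11  *  n  +  10)) := by
  have h6 := CrankModEleven.eleven_mul_crankCount_zero n
  obtain ⟨c0, t0, _, _, _, _, _, _⟩ := CrankModEleven.exists_crankCount_progression n 0
    (u₀ := 1) (u₁ := 0) (u₂ := 0) (u₃ := 0) (u₄ := 0) (u₅ := 0) (by decide)
  obtain ⟨c1, t1, _, _, _, _, _, _⟩ := CrankModEleven.exists_crankCount_progression n 1
    (u₀ := -1) (u₁ := 1) (u₂ := 0) (u₃ := 0) (u₄ := 0) (u₅ := 0) (by decide)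
  obtain ⟨c2, t2, _, _, _, _, _, _⟩ := CrankModEleven.exists_crankCount_progression n 2
    (u₀ := 0) (u₁ := 0) (u₂ := 1) (u₃ := 0) (u₄ := 0) (u₅ := 0) (by decide)
  obtain ⟨c3, t3, _, _, _, _, _, _⟩ := CrankModEleven.exists_crankCount_progression n 3
    (u₀ := 1) (u₁ := 0) (u₂ := 0) (u₃ := 1) (u₄ := 0) (u₅ := 0) (by decide)
  obtain ⟨c4, t4, _, _, _, _, _, _⟩ := CrankModEleven.exists_crankCount_progression n 4
    (u₀ := 1) (u₁ := 0) (u₂ := 1) (u₃ := 0) (u₄ := 1) (u₅ := 0) (by decide)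
  obtain ⟨c5, t5, _, _, _, _, _, _⟩ := CrankModEleven.exists_crankCount_progression n 5
    (u₀ := 0) (u₁ := 0) (u₂ := 1) (u₃ := 0) (u₄ := 1) (u₅ := 0) (by decide)
  obtain ⟨c6, t6, _, _, _, _, _, _⟩ := CrankModEleven.exists_crankCount_progression n 6
    (u₀ := 0) (u₁ := 0) (u₂ := 0) (u₃ := 0) (u₄ := 0) (u₅ := 0) (by decide)
  obtain ⟨c7, t7, _, _, _, _, _, _⟩ := CrankModEleven.exists_crankCount_progression n 7
    (u₀ := 0) (u₁ := 1) (u₂ := 0) (u₃ := 0) (u₄ := 1) (u₅ := 0) (by decide)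
  obtain ⟨c8, t8, _, _, _, _, _, _⟩ := CrankModEleven.exists_crankCount_progression n 8
    (u₀ := 1) (u₁ := 0) (u₂ := 1) (u₃ := 0) (u₄ := 0) (u₅ := 1) (by decide)
  obtain ⟨c9, t9, _, _, _, _, _, _⟩ := CrankModEleven.exists_crankCount_progression n 9
    (u₀ := 1) (u₁ := 0) (u₂ := 0) (u₃ := 0) (u₄ := 1) (u₅ := 0) (by decide)
  obtain ⟨c10, t10, _, _, _, _, _, _⟩ := CrankModEleven.exists_crankCount_progression n 10
    (u₀ := 0) (u₁ := 0) (u₂ := 0) (u₃ := 1) (u₄ := 0) (u₅ := 0) (by decide)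
  simp only [add_zero] at *
  omega
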